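/- arXiv:2505.22237 — 2 statements merged into one kernel-verified Lean document; each statement's English description precedes it below -/
import Mathlib

section
/- Let k be a field (of arbitrary characteristic), let m ≥ 1 be an integer, and let F be a field extension of k. For 1 ≤ i ≤ m let Qᵢ = ℍ[F, c₁ᵢ, c₂ᵢ, c₃ᵢ] be a quaternion algebra over F given by parameters c₁ᵢ, c₂ᵢ, c₃ᵢ ∈ F, and assume the tensor product Q₁ ⊗_F … ⊗_F Q_m is split. Then there exist an intermediate field L with k ⊆ L ⊆ F whose transcendence degree over k is at most 2^m + 2m − 1, and parameters c'₁ᵢ, c'₂ᵢ, c'₃ᵢ ∈ L for 1 ≤ i ≤ m such that ℍ[F, c'₁ᵢ, c'₂ᵢ, c'₃ᵢ] ≅ Qᵢ as F-algebras for each i, and the tensor product ℍ[L, c'₁₁, c'₂₁, c'₃₁] ⊗_L … ⊗_L ℍ[L, c'₁ₘ, c'₂ₘ, c'₃ₘ] is split over L. -/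
open FreeAlgebra in
/-- Relations of the generalized quaternion algebra `ℍ[F, c₁, c₂, c₃]`:
generators `i, j` with `i² = c₁ + c₂·i`, `j² = c₃`, `j·i = c₂·j − i·j`. -/
inductive GQuatRel (F : Type*) [Field F] (c₁ c₂ c₃ : F) :
    FreeAlgebra F (Fin 2) → FreeAlgebra F (Fin 2) → Prop
  | i_sq : GQuatRel F c₁ c₂ c₃ (ι F 0 * ι F 0) (algebraMap F _ c₁ + algebraMap F _ c₂ * ι F 0)
  | j_sq : GQuatRel F c₁ c₂ c₃ (ι F 1 * ι F 1) (algebraMap F _ c₃)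
  | ji : GQuatRel F c₁ c₂ c₃ (ι F 1 * ι F 0) (algebraMap F _ c₂ * ι F 1 - ι F 0 * ι F 1)

/-- The generalized quaternion algebra `ℍ[F, c₁, c₂, c₃]`. -/
def GQuatAlg (F : Type*) [Field F] (c₁ c₂ c₃ : F) : Type _ :=
  RingQuot (GQuatRel F c₁ c₂ c₃)

instance (F : Type*) [Field F] (c₁ c₂ c₃ : F) : Ring (GQuatAlg F c₁ c₂ c₃) :=
  inferInstanceAs (Ring (RingQuot (GQuatRel F c₁ c₂ c₃)))

instance (F : Type*) [Field F] (c₁ c₂ c₃ : F) : Algebra F (GQuatAlg F c₁ c₂ c₃) :=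
  inferInstanceAs (Algebra F (RingQuot (GQuatRel F c₁ c₂ c₃)))

open scoped TensorProduct

/-- The transcendence degree of `L` over `k`: the supremum of cardinalities of
algebraically independent subsets of `L`. -/
noncomputable def trdeg (k L : Type*) [CommRing k] [CommRing L] [Algebra k L] : Cardinal :=
  ⨆ s : { s : Set L // AlgebraicIndependent k ((↑) : s → L) }, Cardinal.mk s.1

open scoped IntermediateField.algebraAdjoinAdjoin in
/-- The algebraic closure of `k(s)` in an extension of `k` has transcendence degree at most `#s`. -/
theorem trdeg_algebraicClosure_adjoin_le (k Ω : Type*) [Field k] [Field Ω] [Algebra k Ω]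
    (s : Set Ω) :
    Algebra.trdeg k ((algebraicClosure (IntermediateField.adjoin k s) Ω).restrictScalars k) ≤
      Cardinal.mk s := by
  let K := IntermediateField.adjoin k s
  let M := algebraicClosure K Ω
  change Algebra.trdeg k M ≤ _
  have : FaithfulSMul K M :=
    (faithfulSMul_iff_algebraMap_injective K M).2 (algebraMap K M).injective
  have hM := trdeg_add_eq k K (A := M)
  have hK := trdeg_add_eq k (Algebra.adjoin k s) (A := K)
  rw [trdeg_eq_zero (R := K) (A := M), add_zero] at hM
  rw [trdeg_eq_zero (R := Algebra.adjoin k s) (A := K), add_zero] at hK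
  rw [← hM, ← hK]
  let f : MvPolynomial s k →ₐ[k] Algebra.adjoin k s :=
    MvPolynomial.aeval fun x => ⟨x.1, Algebra.subset_adjoin x.2⟩
  have hf : Function.Surjective f := by
    have hcomp : (Algebra.adjoin k s).val.comp f = MvPolynomial.aeval Subtype.val := by
      ext x
      simp [f]
    rintro ⟨y, hy⟩
    obtain ⟨x, hx⟩ : y ∈ (MvPolynomial.aeval (R := k) (Subtype.val : s → Ω)).range := by
      rwa [← Algebra.adjoin_eq_range]
    exact ⟨x, Subtype.ext ((AlgHom.congr_fun hcomp x).trans hx)⟩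
  have h2 := lift_trdeg_le_of_surjective f hf
  rw [MvPolynomial.trdeg_of_isDomain] at h2
  simpa using h2

namespace GQuatAlg

section

variable {F : Type*} [Field F] (c₁ c₂ c₃ : F)

/-- The first standard generator. -/
def genI : GQuatAlg F c₁ c₂ c₃ :=
  RingQuot.mkAlgHom F (GQuatRel F c₁ c₂ c₃) (FreeAlgebra.ι F 0)

/-- The second standard generator. -/
def genJ : GQuatAlg F c₁ c₂ c₃ :=
  RingQuot.mkAlgHom F (GQuatRel F c₁ c₂ c₃) (FreeAlgebra.ι F 1)

theorem genI_mul_genI : genI c₁ c₂ c₃ * genI c₁ c₂ c₃ =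
    algebraMap F _ c₁ + algebraMap F _ c₂ * genI c₁ c₂ c₃ := by
  have h := RingQuot.mkAlgHom_rel F (GQuatRel.i_sq (c₁ := c₁) (c₂ := c₂) (c₃ := c₃))
  simp only [map_mul, map_add, AlgHom.commutes] at h
  exact h

theorem genJ_mul_genJ : genJ c₁ c₂ c₃ * genJ c₁ c₂ c₃ = algebraMap F _ c₃ := by
  have h := RingQuot.mkAlgHom_rel F (GQuatRel.j_sq (c₁ := c₁) (c₂ := c₂) (c₃ := c₃))
  simp only [map_mul, AlgHom.commutes] at h
  exact h

theorem genJ_mul_genI : genJ c₁ c₂ c₃ * genI c₁ c₂ c₃ =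
    algebraMap F _ c₂ * genJ c₁ c₂ c₃ - genI c₁ c₂ c₃ * genJ c₁ c₂ c₃ := by
  have h := RingQuot.mkAlgHom_rel F (GQuatRel.ji (c₁ := c₁) (c₂ := c₂) (c₃ := c₃))
  simp only [map_mul, map_sub, AlgHom.commutes] at h
  exact h

variable {c₁ c₂ c₃}

/-- The homomorphism determined by a pair of elements satisfying the defining relations. -/
def lift {B : Type*} [Ring B] [Algebra F B] (x y : B)
    (hx : x * x = algebraMap F B c₁ + algebraMap F B c₂ * x) (hy : y * y = algebraMap F B c₃)
    (hyx : y * x = algebraMap F B c₂ * y - x * y) : GQuatAlg F c₁ c₂ c₃ →ₐ[F] B :=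
  RingQuot.liftAlgHom F ⟨FreeAlgebra.lift F ![x, y], by
    rintro _ _ (_ | _ | _) <;> simpa using by assumption⟩

theorem lift_genI {B : Type*} [Ring B] [Algebra F B] (x y : B)
    (hx : x * x = algebraMap F B c₁ + algebraMap F B c₂ * x) (hy : y * y = algebraMap F B c₃)
    (hyx : y * x = algebraMap F B c₂ * y - x * y) : lift x y hx hy hyx (genI c₁ c₂ c₃) = x :=
  (RingQuot.liftAlgHom_mkAlgHom_apply F _ _ _).trans (by simp)

theorem lift_genJ {B : Type*} [Ring B] [Algebra F B] (x y : B)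
    (hx : x * x = algebraMap F B c₁ + algebraMap F B c₂ * x) (hy : y * y = algebraMap F B c₃)
    (hyx : y * x = algebraMap F B c₂ * y - x * y) : lift x y hx hy hyx (genJ c₁ c₂ c₃) = y :=
  (RingQuot.liftAlgHom_mkAlgHom_apply F _ _ _).trans (by simp)

theorem adjoin_gen : Algebra.adjoin F {genI c₁ c₂ c₃, genJ c₁ c₂ c₃} = ⊤ := by
  rw [eq_top_iff]
  rintro x -
  obtain ⟨a, rfl⟩ := RingQuot.mkAlgHom_surjective F (GQuatRel F c₁ c₂ c₃) x
  induction a using FreeAlgebra.induction with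
  | grade0 r =>
    rw [AlgHom.commutes]
    exact Subalgebra.algebraMap_mem _ r
  | grade1 x =>
    apply Algebra.subset_adjoin
    fin_cases x
    · exact Or.inl rfl
    · exact Or.inr rfl
  | mul a b ha hb =>
    rw [map_mul]
    exact mul_mem ha hb
  | add a b ha hb =>
    rw [map_add]
    exact add_mem ha hb

theorem algHom_ext {B : Type*} [Ring B] [Algebra F B] {f g : GQuatAlg F c₁ c₂ c₃ →ₐ[F] B}
    (hI : f (genI c₁ c₂ c₃) = g (genI c₁ c₂ c₃)) (hJ : f (genJ c₁ c₂ c₃) = g (genJ c₁ c₂ c₃)) :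
    f = g :=
  AlgHom.ext_of_adjoin_eq_top adjoin_gen (by
    rintro x (rfl | rfl)
    exacts [hI, hJ])

variable (c₁ c₂ c₃) in
/-- The spanning family `1, i, j, j * i`. -/
def monomial (p : Fin 2 × Fin 2) : GQuatAlg F c₁ c₂ c₃ :=
  genJ c₁ c₂ c₃ ^ (p.1 : ℕ) * genI c₁ c₂ c₃ ^ (p.2 : ℕ)

theorem span_monomial : Submodule.span F (Set.range (monomial c₁ c₂ c₃)) = ⊤ := by
  set W := Submodule.span F (Set.range (monomial c₁ c₂ c₃)) with hW
  set i := genI c₁ c₂ c₃ with hi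
  set j := genJ c₁ c₂ c₃ with hj
  have hmem (p) : monomial c₁ c₂ c₃ p ∈ W := Submodule.subset_span ⟨p, rfl⟩
  have h1 : (1 : GQuatAlg F c₁ c₂ c₃) ∈ W := by simpa [monomial] using hmem (0, 0)
  have hI : i ∈ W := by simpa [monomial] using hmem (0, 1)
  have hJ : j ∈ W := by simpa [monomial] using hmem (1, 0)
  have hJI : j * i ∈ W := by simpa [monomial] using hmem (1, 1)
  have eII : i * i = c₁ • 1 + c₂ • i := by
    rw [genI_mul_genI, Algebra.algebraMap_eq_smul_one, ← Algebra.smul_def]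
  have eJJ : j * j = c₃ • 1 := by
    rw [genJ_mul_genJ, Algebra.algebraMap_eq_smul_one]
  have eIJ : i * j = c₂ • j - j * i := by
    rw [genJ_mul_genI, ← Algebra.smul_def]; simp [hi, hj]
  have stabI : ∀ w ∈ W, i * w ∈ W := by
    intro w hw
    induction hw using Submodule.span_induction with
    | zero => simp
    | add a b _ _ ha hb => rw [mul_add]; exact add_mem ha hb
    | smul r a _ ha => rw [mul_smul_comm]; exact W.smul_mem _ ha
    | mem x hx =>
      obtain ⟨⟨a, b⟩, rfl⟩ := hx
      fin_cases a <;> fin_cases b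
      · simpa [monomial] using hI
      · simpa [monomial, ← hi, eII] using add_mem (W.smul_mem c₁ h1) (W.smul_mem c₂ hI)
      · simpa [monomial, ← hi, ← hj, eIJ] using sub_mem (W.smul_mem c₂ hJ) hJI
      · have : i * (j * i) = - (c₁ • j) := by
          rw [← mul_assoc, eIJ, sub_mul, mul_assoc, eII]
          simp [mul_add]
        simpa [monomial, ← hi, ← hj, this] using W.smul_mem c₁ hJ
  have stabJ : ∀ w ∈ W, j * w ∈ W := by
    intro w hw
    induction hw using Submodule.span_induction with
    | zero => simp
    | add a b _ _ ha hb => rw [mul_add]; exact add_mem ha hb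
    | smul r a _ ha => rw [mul_smul_comm]; exact W.smul_mem _ ha
    | mem x hx =>
      obtain ⟨⟨a, b⟩, rfl⟩ := hx
      fin_cases a <;> fin_cases b
      · simpa [monomial] using hJ
      · simpa [monomial, ← hi] using hJI
      · simpa [monomial, ← hi, ← hj, eJJ] using (W.smul_mem c₃ h1)
      · simpa [monomial, ← hi, ← hj, ← mul_assoc, eJJ] using W.smul_mem c₃ hI
  rw [eq_top_iff]
  rintro x -
  have hx : x ∈ Algebra.adjoin F {i, j} := by rw [adjoin_gen]; trivial
  suffices ∀ w ∈ W, x * w ∈ W by simpa using this 1 h1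
  induction hx using Algebra.adjoin_induction with
  | mem x hx =>
    rcases hx with rfl | rfl
    exacts [stabI, stabJ]
  | algebraMap r => intro w hw; rw [← Algebra.smul_def]; exact W.smul_mem r hw
  | add a b _ _ ha hb => intro w hw; rw [add_mul]; exact add_mem (ha w hw) (hb w hw)
  | mul a b _ _ ha hb => intro w hw; rw [mul_assoc]; exact ha _ (hb w hw)

/-- Every generalized quaternion algebra has a presentation with second parameter `0` or `1`. -/
theorem exists_normalized (c₁ c₂ c₃ : F) : ∃ d₁ d₂ : F, (d₂ = 0 ∨ d₂ = 1) ∧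
    Nonempty (GQuatAlg F d₁ d₂ c₃ ≃ₐ[F] GQuatAlg F c₁ c₂ c₃) := by
  by_cases h : c₂ = 0
  · exact ⟨c₁, c₂, .inl h, ⟨AlgEquiv.refl⟩⟩
  have eII (a b c : F) : genI a b c * genI a b c = a • 1 + b • genI a b c := by
    rw [genI_mul_genI, Algebra.algebraMap_eq_smul_one, ← Algebra.smul_def]
  have eJI (a b c : F) : genJ a b c * genI a b c = b • genJ a b c - genI a b c * genJ a b c := by
    rw [genJ_mul_genI, ← Algebra.smul_def]
  let f : GQuatAlg F (c₁ / c₂ ^ 2) 1 c₃ →ₐ[F] GQuatAlg F c₁ c₂ c₃ :=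
    lift (c₂⁻¹ • genI c₁ c₂ c₃) (genJ c₁ c₂ c₃)
      (by
        simp only [smul_mul_smul_comm, eII, map_one, one_mul, smul_add, smul_smul,
          Algebra.algebraMap_eq_smul_one]
        congr 2 <;> field_simp)
      (genJ_mul_genJ _ _ _)
      (by
        simp only [mul_smul_comm, smul_mul_assoc, eJI, map_one, one_mul, smul_sub, smul_smul]
        rw [inv_mul_cancel₀ h, one_smul])
  let g : GQuatAlg F c₁ c₂ c₃ →ₐ[F] GQuatAlg F (c₁ / c₂ ^ 2) 1 c₃ :=
    lift (c₂ • genI _ _ _) (genJ _ _ _)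
      (by
        simp only [smul_mul_assoc, mul_smul_comm, eII, smul_add, smul_smul, one_mul,
          Algebra.algebraMap_eq_smul_one]
        congr 2 <;> field_simp)
      (genJ_mul_genJ _ _ _)
      (by
        simp only [mul_smul_comm, smul_mul_assoc, eJI, smul_sub, one_smul, ← Algebra.smul_def])
  refine ⟨_, 1, .inr rfl, ⟨AlgEquiv.ofAlgHom f g (algHom_ext ?_ ?_) (algHom_ext ?_ ?_)⟩⟩ <;>
    simp [f, g, lift_genI, lift_genJ, h]

/-- Base change of parameters. -/
theorem exists_baseChange {L : Type*} [Field L] [Algebra L F] {d₁ d₂ d₃ : L}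
    (h₁ : algebraMap L F d₁ = c₁) (h₂ : algebraMap L F d₂ = c₂) (h₃ : algebraMap L F d₃ = c₃) :
    ∃ f : GQuatAlg L d₁ d₂ d₃ →+* GQuatAlg F c₁ c₂ c₃,
      (∀ r, f (algebraMap L _ r) = algebraMap F _ (algebraMap L F r)) ∧
      ∀ p, f (monomial d₁ d₂ d₃ p) = monomial c₁ c₂ c₃ p := by
  subst h₁ h₂ h₃
  let _ : Algebra L (GQuatAlg F (algebraMap L F d₁) (algebraMap L F d₂) (algebraMap L F d₃)) :=
    Algebra.compHom _ (algebraMap L F)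
  let f := lift (c₁ := d₁) (c₂ := d₂) (c₃ := d₃) (genI (algebraMap L F d₁) (algebraMap L F d₂)
    (algebraMap L F d₃)) (genJ _ _ _) (genI_mul_genI _ _ _) (genJ_mul_genJ _ _ _)
    (genJ_mul_genI _ _ _)
  refine ⟨f, fun r => f.commutes r, fun p => ?_⟩
  simp [monomial, f, lift_genI, lift_genJ]

end

end GQuatAlg

namespace PiTensorProduct

/-- Tensor products of spanning families span the tensor product. -/
theorem span_tprod_comp_eq_top {R ι : Type*} [CommRing R] [Fintype ι] {κ : ι → Type*}
    [∀ i, Fintype (κ i)] {A : ι → Type*} [∀ i, AddCommGroup (A i)] [∀ i, Module R (A i)]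
    (b : ∀ i, κ i → A i) (hb : ∀ i, Submodule.span R (Set.range (b i)) = ⊤) :
    Submodule.span R (Set.range fun p : ∀ i, κ i => tprod R fun i => b i (p i)) = ⊤ := by
  classical
  rw [eq_top_iff, ← span_tprod_eq_top, Submodule.span_le]
  rintro _ ⟨x, rfl⟩
  have h (i) : ∃ a : κ i → R, ∑ j, a j • b i j = x i := by
    rw [← Submodule.mem_span_range_iff_exists_fun, hb]
    trivial
  choose a ha using h
  obtain rfl := funext ha
  rw [MultilinearMap.map_sum]
  refine sum_mem fun p _ => ?_
  rw [MultilinearMap.map_smul_univ]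
  exact Submodule.smul_mem _ _ (Submodule.subset_span ⟨p, rfl⟩)

/-- A homomorphism out of a tensor product over `F` can be composed with semilinear ring
homomorphisms from algebras over a smaller base `L`. -/
theorem exists_algHom_tprod {L F ι C : Type*} [CommRing L] [CommRing F] [Algebra L F]
    {A B : ι → Type*} [∀ i, Ring (A i)] [∀ i, Algebra L (A i)] [∀ i, Ring (B i)]
    [∀ i, Algebra F (B i)] [Ring C] [Algebra F C] [Algebra L C] [IsScalarTower L F C]
    (f : ∀ i, A i →+* B i) (hf : ∀ i r, f i (algebraMap L _ r) = algebraMap F _ (algebraMap L F r))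
    (φ : (⨂[F] i, B i) →ₐ[F] C) :
    ∃ ψ : (⨂[L] i, A i) →ₐ[L] C, ∀ x, ψ (tprod L x) = φ (tprod F fun i => f i (x i)) := by
  have hupd [DecidableEq ι] (x : ∀ i, A i) (i : ι) (a : A i) :
      (fun l => f l (Function.update x i a l)) =
        Function.update (fun l => f l (x l)) i (f i a) := by
    ext l
    exact Function.apply_update (fun l => f l) x i a l
  let g : MultilinearMap L A C :=
    { toFun := fun x => φ (tprod F fun i => f i (x i))
      map_update_add' := by
        intro _ x i a b
        simp only [hupd, map_add, MultilinearMap.map_update_add]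
      map_update_smul' := by
        intro _ x i r a
        have : f i (r • a) = algebraMap L F r • f i a := by
          rw [Algebra.smul_def, map_mul, hf, ← Algebra.smul_def]
        simp only [hupd, this, MultilinearMap.map_update_smul]
        rw [map_smul, algebraMap_smul] }
  refine ⟨liftAlgHom g ?_ fun x y => ?_, fun x => ?_⟩
  · change φ (tprod F fun i => f i 1) = 1
    simp only [map_one]
    exact map_one φ
  · change φ (tprod F fun i => f i (x i * y i)) =
      φ (tprod F fun i => f i (x i)) * φ (tprod F fun i => f i (y i))
    rw [← map_mul, tprod_mul_tprod]
    simp only [map_mul]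
    rfl
  · simp [g]

end PiTensorProduct

/-- Pairwise commuting endomorphisms, each annihilated by a monic quadratic polynomial, have a
common eigenvector over an algebraically closed field. -/
theorem exists_common_eigenvector {Ω V ι : Type*} [Field Ω] [IsAlgClosed Ω] [AddCommGroup V]
    [Module Ω V] [Nontrivial V] [Finite ι] (X : ι → Module.End Ω V)
    (hcomm : ∀ i j, X i * X j = X j * X i) (a b : ι → Ω)
    (hX : ∀ i, X i * X i = a i • 1 + b i • X i) :
    ∃ w : V, w ≠ 0 ∧ ∃ μ : ι → Ω,
      ∀ i, X i w = μ i • w ∧ μ i * μ i = a i + b i * μ i := by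
  classical
  have := Fintype.ofFinite ι
  suffices ∀ s : Finset ι, ∃ w : V, w ≠ 0 ∧ ∀ i ∈ s, ∃ μ : Ω, X i w = μ • w ∧
      μ * μ = a i + b i * μ by
    obtain ⟨w, hw, h⟩ := this Finset.univ
    choose μ hμ using fun i => h i (Finset.mem_univ i)
    exact ⟨w, hw, μ, hμ⟩
  intro s
  induction s using Finset.induction_on with
  | empty =>
    obtain ⟨w, hw⟩ := exists_ne (0 : V)
    exact ⟨w, hw, by simp⟩
  | insert i s _ ih =>
    obtain ⟨w, hw, h⟩ := ih
    have hXX : X i (X i w) = a i • w + b i • X i w := by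
      simpa using LinearMap.congr_fun (hX i) w
    obtain ⟨μ, hμ⟩ : ∃ μ : Ω, μ * μ = a i + b i * μ := by
      obtain ⟨μ, hμ⟩ := IsAlgClosed.exists_eval₂_eq_zero (RingHom.id Ω)
        (Polynomial.X ^ 2 - Polynomial.C (b i) * Polynomial.X - Polynomial.C (a i)) (by
          have : (Polynomial.X ^ 2 - Polynomial.C (b i) * Polynomial.X -
            Polynomial.C (a i)).degree = 2 := by compute_degree!
          simp [this])
      refine ⟨μ, ?_⟩
      simp at hμ
      linear_combination hμ
    by_cases h0 : X i w = (b i - μ) • w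
    · refine ⟨w, hw, fun j hj => ?_⟩
      rcases Finset.mem_insert.1 hj with rfl | hj
      · exact ⟨_, h0, by linear_combination hμ⟩
      · exact h j hj
    · refine ⟨X i w - (b i - μ) • w, sub_ne_zero.2 h0, fun j hj => ?_⟩
      rcases Finset.mem_insert.1 hj with rfl | hj
      · refine ⟨μ, ?_, hμ⟩
        rw [map_sub, map_smul, hXX, smul_sub, smul_smul]
        have : a j = μ * μ - b j * μ := by linear_combination -hμ
        rw [this]
        module
      · obtain ⟨ν, hν, hν'⟩ := h j hj
        refine ⟨ν, ?_, hν'⟩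
        have hc : X j (X i w) = X i (X j w) := LinearMap.congr_fun (hcomm j i) w
        rw [map_sub, map_smul, hc, hν, map_smul]
        module

section Descent

open Matrix

variable {L F M Ω n : Type*} [Field L] [Field F] [Field M] [Field Ω] [Algebra L F] [Algebra F Ω]
  [Algebra M Ω] [Fintype n] [DecidableEq n]

/-- A nonzero vector generates under the action of all matrices over a subfield. -/
theorem span_range_map_mulVec_eq_top {w : n → Ω} (hw : w ≠ 0) :
    Submodule.span Ω (Set.range fun A : Matrix n n F => A.map (algebraMap F Ω) *ᵥ w) = ⊤ := by
  obtain ⟨j, hj⟩ := Function.ne_iff.1 hw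
  rw [eq_top_iff, ← (Pi.basisFun Ω n).span_eq, Submodule.span_le]
  rintro _ ⟨i, rfl⟩
  have h : (Matrix.single i j (1 : F)).map (algebraMap F Ω) *ᵥ w = Pi.single i (w j) := by
    ext l
    by_cases h : i = l <;>
      simp [Matrix.mulVec, dotProduct, Matrix.single_apply,
        apply_ite (algebraMap F Ω), h, eq_comm]
  have h' : Pi.basisFun Ω n i = (w j)⁻¹ • Pi.single i (w j) := by
    rw [← Pi.single_smul, smul_eq_mul, inv_mul_cancel₀ hj, Pi.basisFun_apply]
  rw [h', ← h]
  exact Submodule.smul_mem _ _ (Submodule.subset_span ⟨_, rfl⟩)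

/-- A basis of column vectors stays linearly independent over a larger field. -/
theorem linearIndependent_algebraMap_comp {b : n → n → F} (hb : LinearIndependent F b) :
    LinearIndependent Ω fun j => algebraMap F Ω ∘ b j := by
  have h1 : IsUnit (Matrix.of b) := Matrix.linearIndependent_rows_iff_isUnit.1 hb
  have h2 := h1.map (algebraMap F Ω).mapMatrix
  exact Matrix.linearIndependent_rows_iff_isUnit.2 h2

/-- If a finite family spans `A` over `L` and a homomorphism to matrices over `L` maps it to a
spanning family over an extension, then the homomorphism is bijective, provided the family has
the right cardinality. -/
theorem bijective_of_span_map {A κ : Type*} [Ring A] [Algebra L A] [Fintype κ] (β : κ → A)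
    (hβ : Submodule.span L (Set.range β) = ⊤)
    (hκ : Fintype.card κ = Fintype.card n * Fintype.card n) (N : A →ₐ[L] Matrix n n L)
    (hN : Submodule.span F (Set.range fun p => (N (β p)).map (algebraMap L F)) = ⊤) :
    Function.Bijective N := by
  have hli : LinearIndependent F fun p => (N (β p)).map (algebraMap L F) :=
    linearIndependent_of_top_le_span_of_card_eq_finrank hN.ge
      (by rw [Module.finrank_matrix, Module.finrank_self, hκ, mul_one])
  have hliL : LinearIndependent L fun p => N (β p) := by
    refine LinearIndependent.of_comp ((Algebra.ofId L F).mapMatrix (m := n)).toLinearMap ?_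
    refine hli.restrict_scalars ?_
    intro r s h
    simpa [Algebra.smul_def] using h
  have hliA : LinearIndependent L β := LinearIndependent.of_comp N.toLinearMap hliL
  let bA := Module.Basis.mk hliA hβ.ge
  have := Module.Finite.of_basis bA
  have hfin : Module.finrank L A = Module.finrank L (Matrix n n L) := by
    rw [Module.finrank_eq_card_basis bA, Module.finrank_matrix, Module.finrank_self, hκ, mul_one]
  have hsurj : Function.Surjective N.toLinearMap := by
    rw [← LinearMap.range_eq_top, eq_top_iff,
      ← hliL.span_eq_top_of_card_eq_finrank' (by rw [← hfin, Module.finrank_eq_card_basis bA]),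
      Submodule.span_le]
    rintro _ ⟨p, rfl⟩
    exact ⟨β p, rfl⟩
  exact ⟨(LinearMap.injective_iff_surjective_of_finrank_eq_finrank hfin).2 hsurj, hsurj⟩

/-- Let `L = F ∩ M` inside `Ω`. A representation of an `L`-algebra `A` over `F` which generates
the full matrix algebra, and which stabilises an `M`-form of its extension to `Ω` containing a
nonzero `F`-rational vector, comes from an isomorphism of `A` with a matrix algebra over `L`. -/
theorem nonempty_algEquiv_matrix_of_stable
    (hL : ∀ (x : F) (y : M), algebraMap F Ω x = algebraMap M Ω y → ∃ z, algebraMap L F z = x)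
    {A κ ν : Type*} [Ring A] [Algebra L A] [Fintype κ] [Fintype ν] (β : κ → A)
    (hβ : Submodule.span L (Set.range β) = ⊤)
    (hκ : Fintype.card κ = Fintype.card n * Fintype.card n) (ψ : A →ₐ[L] Matrix n n F)
    (hψ : Submodule.span F (Set.range (ψ ∘ β)) = ⊤)
    (e : ν → n → Ω) (hν : Fintype.card ν = Fintype.card n)
    (hstab : ∀ a, ∀ y ∈ Submodule.span M (Set.range e),
      (ψ a).map (algebraMap F Ω) *ᵥ y ∈ Submodule.span M (Set.range e))
    (v : n → F) (hv : v ≠ 0) (hvW : algebraMap F Ω ∘ v ∈ Submodule.span M (Set.range e)) :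
    Nonempty (A ≃ₐ[L] Matrix n n L) := by
  set W := Submodule.span M (Set.range e) with hW
  have hspan : Submodule.span F (Set.range fun a => ψ a *ᵥ v) = ⊤ := by
    rw [eq_top_iff, ← span_range_map_mulVec_eq_top (F := F) hv, Submodule.span_le]
    rintro _ ⟨B, rfl⟩
    have hB : B ∈ Submodule.span F (Set.range (ψ ∘ β)) := by rw [hψ]; trivial
    simp only [Algebra.algebraMap_self, SetLike.mem_coe, RingHom.coe_id, Matrix.map_id]
    induction hB using Submodule.span_induction with
    | zero => simp
    | add x y _ _ hx hy => rw [Matrix.add_mulVec]; exact add_mem hx hy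
    | smul r x _ hx => rw [Matrix.smul_mulVec]; exact Submodule.smul_mem _ _ hx
    | mem x hx =>
      obtain ⟨p, rfl⟩ := hx
      exact Submodule.subset_span ⟨β p, rfl⟩
  obtain ⟨b, hb⟩ : ∃ b : Module.Basis n F (n → F), ∀ j, ∃ a, b j = ψ a *ᵥ v := by
    obtain ⟨s, hs, hs', hli⟩ := exists_linearIndependent F (Set.range fun a => ψ a *ᵥ v)
    let b := Module.Basis.mk hli (by rw [Subtype.range_coe, hs', hspan])
    let b' := b.reindex (b.indexEquiv (Pi.basisFun F n))
    refine ⟨b', fun j => ?_⟩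
    obtain ⟨a, ha⟩ := hs ((b.indexEquiv (Pi.basisFun F n)).symm j).2
    exact ⟨a, by simp [b', b, ← ha]⟩
  have hmap (B : Matrix n n F) (y : n → F) :
      B.map (algebraMap F Ω) *ᵥ (algebraMap F Ω ∘ y) = algebraMap F Ω ∘ (B *ᵥ y) := by
    ext i
    exact (RingHom.map_mulVec (algebraMap F Ω) B y i).symm
  have hbW (j) : algebraMap F Ω ∘ b j ∈ W := by
    obtain ⟨a, ha⟩ := hb j
    rw [ha, ← hmap]
    exact hstab _ _ hvW
  have hbΩ : LinearIndependent Ω fun j => algebraMap F Ω ∘ b j :=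
    linearIndependent_algebraMap_comp b.linearIndependent
  have hbM : LinearIndependent M fun j => algebraMap F Ω ∘ b j := by
    refine hbΩ.restrict_scalars ?_
    intro r s h
    simpa [Algebra.smul_def] using h
  have : FiniteDimensional M W := FiniteDimensional.span_of_finite M (Set.finite_range e)
  have hWeq : Submodule.span M (Set.range fun j => algebraMap F Ω ∘ b j) = W := by
    refine Submodule.eq_of_le_of_finrank_le (Submodule.span_le.2 ?_) ?_
    · rintro _ ⟨j, rfl⟩
      exact hbW j
    · rw [finrank_span_eq_card hbM, ← hν]
      exact finrank_range_le_card e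
  let ψ' : A →ₐ[L] Matrix n n F :=
    (((Matrix.toLinAlgEquiv' (R := F) (n := n)).trans
      (LinearMap.toMatrixAlgEquiv b)).restrictScalars L).toAlgHom.comp ψ
  have hψ' (a) (j) : ψ a *ᵥ b j = ∑ i, ψ' a i j • b i := by
    have : ∀ i, ψ' a i j = b.repr (ψ a *ᵥ b j) i := fun i => by
      simp [ψ', LinearMap.toMatrixAlgEquiv_apply]
    simp only [this, b.sum_repr]
  have hentry (a) (i j) : ∃ z, algebraMap L F z = ψ' a i j := by
    have hmem : algebraMap F Ω ∘ (ψ a *ᵥ b j) ∈ W := by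
      rw [← hmap]
      exact hstab _ _ (hbW j)
    rw [← hWeq, Submodule.mem_span_range_iff_exists_fun] at hmem
    obtain ⟨μ, hμ⟩ := hmem
    have h1 : ∑ i, algebraMap F Ω (ψ' a i j) • (algebraMap F Ω ∘ b i) =
        ∑ i, algebraMap M Ω (μ i) • (algebraMap F Ω ∘ b i) := by
      have h0 : ∑ i, algebraMap M Ω (μ i) • (algebraMap F Ω ∘ b i) =
          algebraMap F Ω ∘ (ψ a *ᵥ b j) := by
        simpa only [algebraMap_smul] using hμ
      rw [h0, hψ']
      ext l
      simp [Finset.sum_apply, -algebraMap_smul]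
    refine hL _ (μ i) ?_
    have h2 := linearIndependent_iff'.1 hbΩ Finset.univ
      (fun i => algebraMap F Ω (ψ' a i j) - algebraMap M Ω (μ i))
      (by simp only [sub_smul, Finset.sum_sub_distrib, h1, sub_self]) i (Finset.mem_univ i)
    exact sub_eq_zero.1 h2
  let inc : Matrix n n L →ₐ[L] Matrix n n F := (Algebra.ofId L F).mapMatrix
  have hinc : Function.Injective inc := by
    intro B C h
    ext i j
    exact (algebraMap L F).injective (congrFun (congrFun h i) j)
  have hrange (a) : ψ' a ∈ inc.range := by
    choose z hz using hentry a
    exact ⟨Matrix.of z, by ext i j; exact hz i j⟩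
  let N : A →ₐ[L] Matrix n n L :=
    (AlgEquiv.ofInjective inc hinc).symm.toAlgHom.comp (ψ'.codRestrict inc.range hrange)
  have hN (a) : (N a).map (algebraMap L F) = ψ' a :=
    congrArg Subtype.val ((AlgEquiv.ofInjective inc hinc).apply_symm_apply ⟨ψ' a, hrange a⟩)
  refine ⟨AlgEquiv.ofBijective N (bijective_of_span_map (F := F) β hβ hκ N ?_)⟩
  simp only [hN]
  let E : Matrix n n F ≃ₗ[F] Matrix n n F :=
    ((Matrix.toLinAlgEquiv' (R := F) (n := n)).trans (LinearMap.toMatrixAlgEquiv b)).toLinearEquiv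
  have h3 : (Set.range fun p => ψ' (β p)) = E '' Set.range (ψ ∘ β) := by
    rw [← Set.range_comp]
    rfl
  rw [h3, ← LinearEquiv.coe_coe, ← Submodule.map_span, hψ, Submodule.map_top, LinearEquiv.range]

end Descent

namespace GQuatAlg

open Matrix PiTensorProduct

section Eigenvector

variable {F Ω ι n : Type*} [Field F] [Field Ω] [Algebra F Ω] [Fintype ι] [DecidableEq ι]
  [Fintype n] [DecidableEq n] {c₁ c₂ c₃ : ι → F}

/-- A common eigenvector of the generators `i` of all the factors of a tensor product of
quaternion algebras acting on `n → Ω`. -/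
theorem exists_eigenvector [IsAlgClosed Ω] [Nonempty n]
    (φ : (⨂[F] i, GQuatAlg F (c₁ i) (c₂ i) (c₃ i)) →ₐ[F] Matrix n n F) :
    ∃ w : n → Ω, w ≠ 0 ∧ ∃ μ : ι → Ω,
      (∀ i, (φ (singleAlgHom i (genI (c₁ i) (c₂ i) (c₃ i)))).map (algebraMap F Ω) *ᵥ w =
        μ i • w) ∧
      ∀ i, μ i * μ i = algebraMap F Ω (c₁ i) + algebraMap F Ω (c₂ i) * μ i := by
  let x (i) := singleAlgHom (R := F) (A := fun i => GQuatAlg F (c₁ i) (c₂ i) (c₃ i)) i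
    (genI (c₁ i) (c₂ i) (c₃ i))
  let ρ : (⨂[F] i, GQuatAlg F (c₁ i) (c₂ i) (c₃ i)) →ₐ[F] Matrix n n Ω :=
    ((Algebra.ofId F Ω).mapMatrix).comp φ
  have hcomm (i j) : x i * x j = x j * x i := by
    by_cases h : i = j
    · rw [h]
    · simp only [x, singleAlgHom_apply, tprod_mul_tprod, MonoidHom.mulSingle_apply]
      exact congrArg _ (Pi.mulSingle_commute h _ _)
  have hsq (i) : x i * x i = c₁ i • 1 + c₂ i • x i := by
    simp only [x]
    rw [← map_mul, genI_mul_genI, map_add, map_mul, AlgHom.commutes, AlgHom.commutes,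
      ← Algebra.smul_def, Algebra.algebraMap_eq_smul_one]
  obtain ⟨w, hw, μ, hμ⟩ := exists_common_eigenvector
    (fun i => Matrix.toLinAlgEquiv' (ρ (x i)))
    (fun i j => by rw [← map_mul, ← map_mul, ← map_mul, ← map_mul, hcomm])
    (fun i => algebraMap F Ω (c₁ i)) (fun i => algebraMap F Ω (c₂ i))
    (fun i => by
      rw [← map_mul, ← map_mul, hsq, map_add, map_smul, map_smul, map_one,
        ← algebraMap_smul Ω (c₁ i), ← algebraMap_smul Ω (c₂ i), map_add, map_smul, map_smul,
        map_one])
  refine ⟨w, hw, μ, fun i => ?_, fun i => (hμ i).2⟩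
  exact (Matrix.toLinAlgEquiv'_apply _ _).symm.trans (hμ i).1

/-- The action of the monomials on a common eigenvector. -/
theorem tprod_monomial_mulVec
    (φ : (⨂[F] i, GQuatAlg F (c₁ i) (c₂ i) (c₃ i)) →ₐ[F] Matrix n n F) {w : n → Ω} {μ : ι → Ω}
    (hw : ∀ i, (φ (singleAlgHom i (genI (c₁ i) (c₂ i) (c₃ i)))).map (algebraMap F Ω) *ᵥ w =
      μ i • w) (p : ι → Fin 2 × Fin 2) :
    (φ (tprod F fun i => monomial (c₁ i) (c₂ i) (c₃ i) (p i))).map (algebraMap F Ω) *ᵥ w =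
      (∏ i, μ i ^ ((p i).2 : ℕ)) •
        ((φ (tprod F fun i => genJ (c₁ i) (c₂ i) (c₃ i) ^ ((p i).1 : ℕ))).map
          (algebraMap F Ω) *ᵥ w) := by
  have hpow (i) (t : ℕ) : (φ (singleAlgHom i (genI (c₁ i) (c₂ i) (c₃ i) ^ t))).map
      (algebraMap F Ω) *ᵥ w = μ i ^ t • w := by
    induction t with
    | zero => simp [map_one, -singleAlgHom_apply]
    | succ t ih =>
      rw [pow_succ, map_mul, map_mul, Matrix.map_mul, ← Matrix.mulVec_mulVec, hw,
        Matrix.mulVec_smul, ih, smul_smul, pow_succ']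
  have key (s : Finset ι) : (φ (tprod F fun i => if i ∈ s then
      genI (c₁ i) (c₂ i) (c₃ i) ^ ((p i).2 : ℕ) else 1)).map (algebraMap F Ω) *ᵥ w =
      (∏ i ∈ s, μ i ^ ((p i).2 : ℕ)) • w := by
    induction s using Finset.induction_on with
    | empty =>
      have : φ (tprod F fun i => (1 : GQuatAlg F (c₁ i) (c₂ i) (c₃ i))) = 1 := map_one φ
      simp [this]
    | insert a s ha ih =>
      have : (fun i => if i ∈ insert a s then genI (c₁ i) (c₂ i) (c₃ i) ^ ((p i).2 : ℕ) else 1) =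
          Pi.mulSingle a (genI (c₁ a) (c₂ a) (c₃ a) ^ ((p a).2 : ℕ)) *
          fun i => if i ∈ s then genI (c₁ i) (c₂ i) (c₃ i) ^ ((p i).2 : ℕ) else 1 := by
        ext i
        by_cases h : i = a
        · subst h
          simp [ha]
        · simp [h]
      rw [this, ← tprod_mul_tprod, map_mul, Matrix.map_mul, ← Matrix.mulVec_mulVec, ih,
        Matrix.mulVec_smul, Finset.prod_insert ha, mul_comm, mul_smul]
      congr 1
      exact hpow a _
  have h : (fun i => monomial (c₁ i) (c₂ i) (c₃ i) (p i)) =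
      (fun i => genJ (c₁ i) (c₂ i) (c₃ i) ^ ((p i).1 : ℕ)) *
        fun i => genI (c₁ i) (c₂ i) (c₃ i) ^ ((p i).2 : ℕ) := rfl
  rw [h, ← tprod_mul_tprod, map_mul, Matrix.map_mul, ← Matrix.mulVec_mulVec]
  have := key Finset.univ
  simp only [Finset.mem_univ, if_true] at this
  rw [this, Matrix.mulVec_smul]

end Eigenvector

/-- A split tensor product of quaternion algebras whose second parameters are `0` or `1` descends
to a subfield of small transcendence degree. -/
theorem exists_descent {k F ι n : Type*} [Field k] [Field F] [Algebra k F] [Fintype ι]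
    [Fintype n] [DecidableEq n] (hn : Fintype.card n = 2 ^ Fintype.card ι)
    (c₁ c₂ c₃ : ι → F) (hc₂ : ∀ i, c₂ i = 0 ∨ c₂ i = 1)
    (φ : (⨂[F] i, GQuatAlg F (c₁ i) (c₂ i) (c₃ i)) →ₐ[F] Matrix n n F)
    (hφ : Function.Surjective φ) :
    ∃ L : IntermediateField k F,
      Algebra.trdeg k L ≤ ((2 ^ Fintype.card ι + 2 * Fintype.card ι - 1 : ℕ) : Cardinal) ∧
      ∃ d₁ d₂ d₃ : ι → L, (∀ i, (d₁ i : F) = c₁ i) ∧ (∀ i, (d₂ i : F) = c₂ i) ∧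
        (∀ i, (d₃ i : F) = c₃ i) ∧
        Nonempty ((⨂[L] i, GQuatAlg L (d₁ i) (d₂ i) (d₃ i)) ≃ₐ[L] Matrix n n L) := by
  classical
  have : Nonempty n := Fintype.card_pos_iff.1 (hn ▸ by positivity)
  let Ω := AlgebraicClosure F
  obtain ⟨w, hw, μ, hμ, hμ'⟩ := exists_eigenvector (Ω := Ω) φ
  let act (a : ⨂[F] i, GQuatAlg F (c₁ i) (c₂ i) (c₃ i)) : Matrix n n Ω :=
    (φ a).map (algebraMap F Ω)
  let e (S : ι → Fin 2) : n → Ω :=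
    act (tprod F fun i => genJ (c₁ i) (c₂ i) (c₃ i) ^ (S i : ℕ)) *ᵥ w
  have hmonF := span_tprod_comp_eq_top (R := F) (fun i => monomial (c₁ i) (c₂ i) (c₃ i))
    (fun i => span_monomial)
  have he : Submodule.span Ω (Set.range e) = ⊤ := by
    rw [eq_top_iff, ← span_range_map_mulVec_eq_top (F := F) hw, Submodule.span_le]
    rintro _ ⟨B, rfl⟩
    obtain ⟨a, rfl⟩ := hφ B
    have ha : a ∈ Submodule.span F (Set.range fun p : ι → Fin 2 × Fin 2 =>
      tprod F fun i => monomial (c₁ i) (c₂ i) (c₃ i) (p i)) := by rw [hmonF]; trivial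
    induction ha using Submodule.span_induction with
    | zero => simp
    | add x y _ _ hx hy =>
      simp only [map_add, Matrix.map_add (algebraMap F Ω) (map_add _), Matrix.add_mulVec]
      exact add_mem hx hy
    | smul r x _ hx =>
      have : (φ (r • x)).map (algebraMap F Ω) = algebraMap F Ω r • (φ x).map (algebraMap F Ω) := by
        rw [map_smul]
        ext i j
        simp
      simp only [this, Matrix.smul_mulVec]
      exact Submodule.smul_mem _ _ hx
    | mem x hx =>
      obtain ⟨p, rfl⟩ := hx
      simp only [tprod_monomial_mulVec φ hμ]
      exact Submodule.smul_mem _ _ (Submodule.subset_span ⟨fun i => (p i).1, rfl⟩)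
  obtain ⟨v, hv⟩ := exists_ne (0 : n → F)
  obtain ⟨u, hu⟩ : ∃ u : (ι → Fin 2) → Ω, ∑ S, u S • e S = algebraMap F Ω ∘ v := by
    rw [← Submodule.mem_span_range_iff_exists_fun, he]
    trivial
  obtain ⟨S₀, hS₀⟩ : ∃ S₀, u S₀ ≠ 0 := by
    by_contra! h
    apply hv
    ext j
    have := congrFun hu j
    exact (map_eq_zero (algebraMap F Ω)).1 (by simpa [h] using this.symm)
  let e' (S : ι → Fin 2) : n → Ω := u S₀ • e S
  let u' (S : ι → Fin 2) : Ω := (u S₀)⁻¹ * u S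
  have hu' : ∑ S, u' S • e' S = algebraMap F Ω ∘ v := by
    rw [← hu]
    refine Finset.sum_congr rfl fun S _ => ?_
    simp only [u', e']
    rw [smul_smul, mul_right_comm, inv_mul_cancel₀ hS₀, one_mul]
  let s : Finset Ω := (Finset.univ.image (fun i => algebraMap F Ω (c₁ i)) ∪
    Finset.univ.image (fun i => algebraMap F Ω (c₃ i))) ∪ (Finset.univ.erase S₀).image u'
  have hs : s.card ≤ 2 ^ Fintype.card ι + 2 * Fintype.card ι - 1 := by
    have h1 : (Finset.univ.image (fun i => algebraMap F Ω (c₁ i))).card ≤ Fintype.card ι :=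
      Finset.card_image_le
    have h2 : (Finset.univ.image (fun i => algebraMap F Ω (c₃ i))).card ≤ Fintype.card ι :=
      Finset.card_image_le
    have h3 : ((Finset.univ.erase S₀).image u').card ≤ 2 ^ Fintype.card ι - 1 := by
      refine Finset.card_image_le.trans ?_
      rw [Finset.card_erase_of_mem (Finset.mem_univ _)]
      simp
    have h4 : s.card ≤ (Finset.univ.image (fun i => algebraMap F Ω (c₁ i)) ∪
        Finset.univ.image (fun i => algebraMap F Ω (c₃ i))).card +
        ((Finset.univ.erase S₀).image u').card := Finset.card_union_le _ _
    have h5 := Finset.card_union_le (Finset.univ.image (fun i => algebraMap F Ω (c₁ i)))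
      (Finset.univ.image (fun i => algebraMap F Ω (c₃ i)))
    have h6 : 0 < 2 ^ Fintype.card ι := by positivity
    generalize 2 ^ Fintype.card ι = N at *
    omega
  let K := IntermediateField.adjoin k (s : Set Ω)
  let M : IntermediateField k Ω := (algebraicClosure K Ω).restrictScalars k
  have hsM {x : Ω} (hx : x ∈ s) : x ∈ M :=
    mem_algebraicClosure_iff.2
      (isAlgebraic_algebraMap (A := Ω) (⟨x, IntermediateField.subset_adjoin k _ hx⟩ : K))
  have hc₁M (i) : algebraMap F Ω (c₁ i) ∈ M := hsM (by simp [s])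
  have hc₃M (i) : algebraMap F Ω (c₃ i) ∈ M := hsM (by simp [s])
  have hc₂M (i) : algebraMap F Ω (c₂ i) ∈ M := by
    rcases hc₂ i with h | h <;> simp [h, zero_mem, one_mem]
  have hu'M (S) : u' S ∈ M := by
    by_cases h : S = S₀
    · subst h
      simp [u', hS₀, one_mem]
    · exact hsM (Finset.mem_union_right _ (Finset.mem_image_of_mem _ (by simp [h])))
  have hμM (i) : μ i ∈ M := by
    have : IsAlgebraic (algebraicClosure K Ω) (μ i) := by
      refine ⟨.X ^ 2 - (.C ⟨_, hc₂M i⟩ * .X + .C ⟨_, hc₁M i⟩), ?_, ?_⟩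
      · refine ((Polynomial.monic_X_pow 2).sub_of_left ?_).ne_zero
        rw [Polynomial.degree_X_pow]
        exact Polynomial.degree_linear_le.trans_lt (by norm_num)
      · rw [map_sub, map_add, map_mul, map_pow, Polynomial.aeval_X, Polynomial.aeval_C,
          Polynomial.aeval_C, pow_two, hμ', add_comm, sub_eq_zero]
        rfl
    exact mem_algebraicClosure_iff.2 (this.restrictScalars K)
  let L : IntermediateField k F := M.comap (IsScalarTower.toAlgHom k F Ω)
  refine ⟨L, ?_, fun i => ⟨c₁ i, hc₁M i⟩, fun i => ⟨c₂ i, hc₂M i⟩, fun i => ⟨c₃ i, hc₃M i⟩,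
    fun i => rfl, fun i => rfl, fun i => rfl, ?_⟩
  · let j : L →ₐ[k] M := ((IsScalarTower.toAlgHom k F Ω).comp L.val).codRestrict M.toSubalgebra
      fun x => x.2
    refine (trdeg_le_of_injective j fun x y h => ?_).trans
      ((trdeg_algebraicClosure_adjoin_le k Ω s).trans ?_)
    · exact Subtype.ext ((algebraMap F Ω).injective (congrArg Subtype.val h))
    · simpa using hs
  choose f hf hf' using fun i => exists_baseChange (L := L) (F := F) (d₁ := ⟨c₁ i, hc₁M i⟩)
    (d₂ := ⟨c₂ i, hc₂M i⟩) (d₃ := ⟨c₃ i, hc₃M i⟩) (c₁ := c₁ i) (c₂ := c₂ i) (c₃ := c₃ i)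
    rfl rfl rfl
  obtain ⟨ψ, hψ⟩ := exists_algHom_tprod f hf φ
  have hmonL := span_tprod_comp_eq_top (R := L) (fun i => monomial (⟨c₁ i, hc₁M i⟩ : L)
    ⟨c₂ i, hc₂M i⟩ ⟨c₃ i, hc₃M i⟩) (fun i => span_monomial)
  have hψmon (p : ι → Fin 2 × Fin 2) : ψ (tprod L fun i => monomial (⟨c₁ i, hc₁M i⟩ : L)
      ⟨c₂ i, hc₂M i⟩ ⟨c₃ i, hc₃M i⟩ (p i)) =
      φ (tprod F fun i => monomial (c₁ i) (c₂ i) (c₃ i) (p i)) := by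
    rw [hψ]
    simp only [hf']
  refine nonempty_algEquiv_matrix_of_stable (F := F) (M := M) (Ω := Ω) ?_ _ hmonL ?_ ψ ?_ e' ?_ ?_
    v hv ?_
  · intro x y h
    refine ⟨⟨x, ?_⟩, rfl⟩
    change algebraMap F Ω x ∈ M
    rw [h]
    exact y.2
  · simp [hn, ← mul_pow]
  · have : (ψ ∘ fun p : ι → Fin 2 × Fin 2 => tprod L fun i => monomial (⟨c₁ i, hc₁M i⟩ : L)
      ⟨c₂ i, hc₂M i⟩ ⟨c₃ i, hc₃M i⟩ (p i)) =
        φ.toLinearMap ∘ fun p => tprod F fun i => monomial (c₁ i) (c₂ i) (c₃ i) (p i) :=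
      funext hψmon
    rw [this, Set.range_comp, ← Submodule.map_span, hmonF, Submodule.map_top]
    exact LinearMap.range_eq_top.2 hφ
  · simp [hn]
  · have hactw (a) : (ψ a).map (algebraMap F Ω) *ᵥ (u S₀ • w) ∈
        Submodule.span M (Set.range e') := by
      have ha : a ∈ Submodule.span L (Set.range fun p : ι → Fin 2 × Fin 2 =>
          tprod L fun i => monomial (⟨c₁ i, hc₁M i⟩ : L) ⟨c₂ i, hc₂M i⟩ ⟨c₃ i, hc₃M i⟩ (p i)) := by
        rw [hmonL]
        trivial
      induction ha using Submodule.span_induction with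
      | zero => simp
      | add x y _ _ hx hy =>
        rw [map_add, Matrix.map_add (algebraMap F Ω) (map_add _), Matrix.add_mulVec]
        exact add_mem hx hy
      | smul r x _ hx =>
        have : (ψ (r • x)).map (algebraMap F Ω) =
            algebraMap F Ω r • (ψ x).map (algebraMap F Ω) := by
          rw [map_smul]
          ext i j
          exact map_mul (algebraMap F Ω) _ _
        rw [this, Matrix.smul_mulVec]
        exact Submodule.smul_mem _ (⟨algebraMap F Ω r, r.2⟩ : M) hx
      | mem x hx =>
        obtain ⟨p, rfl⟩ := hx
        rw [hψmon, Matrix.mulVec_smul, tprod_monomial_mulVec φ hμ, smul_comm]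
        exact Submodule.smul_mem _
          (⟨_, prod_mem fun i _ => pow_mem (hμM i) _⟩ : M)
          (Submodule.subset_span ⟨fun i => (p i).1, rfl⟩)
    have he' (S) : e' S = (ψ (tprod L fun i => monomial (⟨c₁ i, hc₁M i⟩ : L)
        ⟨c₂ i, hc₂M i⟩ ⟨c₃ i, hc₃M i⟩ (S i, 0))).map (algebraMap F Ω) *ᵥ (u S₀ • w) := by
      rw [hψmon, Matrix.mulVec_smul]
      simp [e', e, act, monomial]
    intro a y hy
    induction hy using Submodule.span_induction with
    | zero => simp
    | add x y _ _ hx hy => rw [Matrix.mulVec_add]; exact add_mem hx hy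
    | smul r x _ hx => rw [Matrix.mulVec_smul]; exact Submodule.smul_mem _ _ hx
    | mem x hx =>
      obtain ⟨S, rfl⟩ := hx
      rw [he', Matrix.mulVec_mulVec, ← Matrix.map_mul, ← map_mul]
      exact hactw _
  · rw [← hu']
    refine sum_mem fun S _ => ?_
    exact Submodule.smul_mem _ (⟨u' S, hu'M S⟩ : M) (Submodule.subset_span ⟨S, rfl⟩)

end GQuatAlg

set_option maxSynthPendingDepth 3 in
set_option maxHeartbeats 1000000 in
set_option synthInstance.maxHeartbeats 1000000 in
theorem stmt7 (k F : Type*) [Field k] [Field F] [Algebra k F]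
    (m : ℕ) (hm : 1 ≤ m) (c₁ c₂ c₃ : Fin m → F)
    (hsplit : Nonempty
      ((⨂[F] i, GQuatAlg F (c₁ i) (c₂ i) (c₃ i)) ≃ₐ[F]
        Matrix (Fin (2 ^ m)) (Fin (2 ^ m)) F)) :
    ∃ L : IntermediateField k F, trdeg k L ≤ ((2 ^ m + 2 * m - 1 : ℕ) : Cardinal) ∧
      ∃ c₁' c₂' c₃' : Fin m → L,
        (∀ i, Nonempty (GQuatAlg F (c₁' i : F) (c₂' i : F) (c₃' i : F) ≃ₐ[F]
          GQuatAlg F (c₁ i) (c₂ i) (c₃ i))) ∧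
        Nonempty
          ((⨂[L] i, GQuatAlg L (c₁' i) (c₂' i) (c₃' i)) ≃ₐ[L]
            Matrix (Fin (2 ^ m)) (Fin (2 ^ m)) L) := by
  obtain ⟨φ⟩ := hsplit
  choose b₁ b₂ hb e using fun i => GQuatAlg.exists_normalized (c₁ i) (c₂ i) (c₃ i)
  obtain ⟨ψ, hψ⟩ := PiTensorProduct.exists_algHom_tprod (L := F)
    (fun i => ((e i).some : GQuatAlg F (b₁ i) (b₂ i) (c₃ i) →+* GQuatAlg F (c₁ i) (c₂ i) (c₃ i)))
    (fun i r => (e i).some.commutes r) φ.toAlgHom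
  have hsurj : Function.Surjective ψ := by
    intro B
    obtain ⟨a, rfl⟩ := φ.surjective B
    induction a using PiTensorProduct.induction_on with
    | smul_tprod r x =>
      refine ⟨r • PiTensorProduct.tprod F fun i => (e i).some.symm (x i), ?_⟩
      rw [map_smul, map_smul, hψ]
      simp
    | add x y hx hy =>
      obtain ⟨x', hx'⟩ := hx
      obtain ⟨y', hy'⟩ := hy
      exact ⟨x' + y', by rw [map_add, map_add, hx', hy']⟩
  obtain ⟨L, hL, d₁, d₂, d₃, h₁, h₂, h₃, hd⟩ :=
    GQuatAlg.exists_descent (k := k) (by simp) b₁ b₂ c₃ hb ψ hsurj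
  refine ⟨L, by rw [Fintype.card_fin] at hL; exact hL, d₁, d₂, d₃, fun i => ?_, hd⟩
  rw [h₁, h₂, h₃]
  exact e i
end

section
/- Let k be an algebraically closed field of characteristic 2, let m ≥ 2 be an integer, and let F = k(X, Y₁, …, Y_{m−1}) be the rational function field in m variables over k. Consider the quaternion algebras Qᵢ = [X, Yᵢ)_F for 1 ≤ i ≤ m−1 and Q_m = [X, Y₁⋯Y_{m−1})_F. Then: (1) the tensor product Q₁ ⊗_F … ⊗_F Q_m is split; and (2) there do NOT exist an intermediate field L with k ⊆ L ⊆ F of transcendence degree at most m−1 over k together with elements a'ᵢ ∈ L and b'ᵢ ∈ L \ {0} (1 ≤ i ≤ m) such that [a'ᵢ,b'ᵢ)_F ≅ Qᵢ as F-algebras for each i and the tensor product [a'₁,b'₁)_L ⊗_L … ⊗_L [a'_m,b'_m)_L is split over L. -/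
open FreeAlgebra in
inductive QuatRel (F : Type*) [Field F] (a b : F) :
    FreeAlgebra F (Fin 2) → FreeAlgebra F (Fin 2) → Prop
  | u_sq : QuatRel F a b (ι F 0 * ι F 0 - ι F 0) (algebraMap F _ a)
  | v_sq : QuatRel F a b (ι F 1 * ι F 1) (algebraMap F _ b)
  | vu : QuatRel F a b (ι F 1 * ι F 0) ((1 - ι F 0) * ι F 1)

/-- The quaternion algebra `[a,b)_F` over a field of characteristic `2`:
generated by `u, v` with `u² - u = a`, `v² = b`, `vu = (1-u)v`. -/
def QuatAlg (F : Type*) [Field F] (a b : F) : Type _ :=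
  RingQuot (QuatRel F a b)

instance (F : Type*) [Field F] (a b : F) : Ring (QuatAlg F a b) :=
  inferInstanceAs (Ring (RingQuot (QuatRel F a b)))

instance (F : Type*) [Field F] (a b : F) : Algebra F (QuatAlg F a b) :=
  inferInstanceAs (Algebra F (RingQuot (QuatRel F a b)))

open scoped TensorProduct

/-- The rational function field `k(X, Y₁, …, Y_m)` in `m+1` variables. -/
def RatFunc' (k : Type*) [Field k] (m : ℕ) : Type _ :=
  FractionRing (MvPolynomial (Fin (m + 1)) k)

noncomputable instance (k : Type*) [Field k] (m : ℕ) : Field (RatFunc' k m) :=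
  inferInstanceAs (Field (FractionRing (MvPolynomial (Fin (m + 1)) k)))

noncomputable instance (k : Type*) [Field k] (m : ℕ) : Algebra k (RatFunc' k m) :=
  inferInstanceAs (Algebra k (FractionRing (MvPolynomial (Fin (m + 1)) k)))

noncomputable instance (k : Type*) [Field k] (m : ℕ) :
    Algebra (MvPolynomial (Fin (m + 1)) k) (RatFunc' k m) :=
  inferInstanceAs (Algebra (MvPolynomial (Fin (m + 1)) k)
    (FractionRing (MvPolynomial (Fin (m + 1)) k)))

/-- The variable `X`. -/
noncomputable def Xvar (k : Type*) [Field k] (m : ℕ) : RatFunc' k m :=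
  algebraMap (MvPolynomial (Fin (m + 1)) k) _ (MvPolynomial.X 0)

/-- The variables `Y₁, …, Y_m`. -/
noncomputable def Yvar (k : Type*) [Field k] (m : ℕ) (i : Fin m) : RatFunc' k m :=
  algebraMap (MvPolynomial (Fin (m + 1)) k) _ (MvPolynomial.X i.succ)

/-- The second slots `Y₁, …, Y_m, Y₁⋯Y_m` of the quaternion algebras. -/
noncomputable def bslot (k : Type*) [Field k] (m : ℕ) : Fin (m + 1) → RatFunc' k m :=
  Fin.snoc (Yvar k m) (∏ i, Yvar k m i)

open MvPolynomial in
theorem height_vanishingIdeal_zero {k : Type*} [Field k] [IsAlgClosed k] {σ : Type*} [Fintype σ] :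
    ((Fintype.card σ : ℕ) : ℕ∞) ≤ (vanishingIdeal k {(0 : σ → k)}).height := by
  have h := ringKrullDim_of_isNoetherianRing (R := k) (ι := σ)
  rw [ringKrullDim_eq_zero_of_field, zero_add, Nat.card_eq_fintype_card] at h
  have : FiniteRingKrullDim (MvPolynomial σ k) :=
    finiteRingKrullDim_iff_ne_bot_and_top.2 ⟨by rw [h]; simp, by rw [h]; exact ne_of_lt (WithBot.coe_lt_coe.2 (ENat.natCast_lt_top _))⟩
  obtain ⟨M, hM, hMh⟩ := Ideal.exists_isMaximal_height (R := MvPolynomial σ k)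
  obtain ⟨a, rfl⟩ := (isMaximal_iff_eq_vanishingIdeal_singleton (I := M)).1 hM
  let e : MvPolynomial σ k ≃ₐ[k] MvPolynomial σ k :=
    AlgEquiv.ofAlgHom (aeval fun i => X i + C (a i)) (aeval fun i => X i - C (a i))
      (by ext i; simp) (by ext i; simp)
  have he : vanishingIdeal k {a} = (vanishingIdeal k {(0 : σ → k)}).comap e.toRingEquiv := by
    ext p
    rw [Ideal.mem_comap, mem_vanishingIdeal_singleton_iff, mem_vanishingIdeal_singleton_iff]
    have : (aeval (0 : σ → k)).comp e.toAlgHom = aeval a := by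
      ext i; simp [e]
    rw [← this]
    rfl
  rw [he, RingEquiv.height_comap] at hMh
  rw [← hMh] at h
  exact le_of_eq (by exact_mod_cast h.symm)

open MvPolynomial in
theorem exists_ne_zero_forall_eval_eq_zero {k : Type*} [Field k] [IsAlgClosed k]
    {σ τ : Type*} [Fintype σ] [Fintype τ] (hcard : Fintype.card τ < Fintype.card σ)
    (f : τ → MvPolynomial σ k) (hf : ∀ j, eval 0 (f j) = 0) :
    ∃ x : σ → k, x ≠ 0 ∧ ∀ j, eval x (f j) = 0 := by
  by_contra! hcon
  have hm : (vanishingIdeal k {(0 : σ → k)}).IsMaximal :=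
    isMaximal_iff_eq_vanishingIdeal_singleton.2 ⟨0, rfl⟩
  have hmin : vanishingIdeal k {(0 : σ → k)} ∈ (Ideal.span (Set.range f)).minimalPrimes := by
    refine ⟨⟨hm.isPrime, ?_⟩, ?_⟩
    · rw [Ideal.span_le]
      rintro _ ⟨j, rfl⟩
      rw [SetLike.mem_coe, mem_vanishingIdeal_singleton_iff]
      simpa [aeval_eq_eval] using hf j
    · rintro p ⟨hp, hle⟩ -
      rw [← IsPrime.vanishingIdeal_zeroLocus (K := k) p]
      refine vanishingIdeal_anti_mono fun x hx => ?_
      by_contra hx0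
      obtain ⟨j, hj⟩ := hcon x hx0
      exact hj (by simpa [aeval_eq_eval] using hx (f j) (hle (Ideal.subset_span ⟨j, rfl⟩)))
  have h1 := Ideal.height_le_card_of_mem_minimalPrimes_span (Set.finite_range f) hmin
  have h2 : (Set.range f).ncard ≤ Fintype.card τ := by
    rw [← Nat.card_coe_set_eq, ← Nat.card_eq_fintype_card]
    exact Finite.card_range_le f
  have h3 := (height_vanishingIdeal_zero (k := k) (σ := σ)).trans h1
  have : Fintype.card σ ≤ (Set.range f).ncard := by exact_mod_cast h3
  omega

open Module in
theorem exists_ne_zero_bilin_self_eq_zero {k V W : Type*} [Field k] [IsAlgClosed k]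
    [AddCommGroup V] [Module k V] [AddCommGroup W] [Module k W] [FiniteDimensional k V]
    [FiniteDimensional k W] (h : finrank k W < finrank k V) (B : V →ₗ[k] V →ₗ[k] W) :
    ∃ x : V, x ≠ 0 ∧ B x x = 0 := by
  let v := finBasis k V
  let w := finBasis k W
  let f : Fin (finrank k W) → MvPolynomial (Fin (finrank k V)) k := fun j =>
    ∑ a, ∑ b, MvPolynomial.C (w.repr (B (v b) (v a)) j) * MvPolynomial.X a * MvPolynomial.X b
  obtain ⟨z, hz, hz'⟩ := exists_ne_zero_forall_eval_eq_zero (by simpa using h) f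
    (fun j => by simp [f])
  refine ⟨v.equivFun.symm z, v.equivFun.symm.map_ne_zero_iff.2 hz, ?_⟩
  apply w.repr.injective
  ext j
  have := hz' j
  simp only [f, map_sum, map_mul, MvPolynomial.eval_C, MvPolynomial.eval_X] at this
  rw [map_zero, Finsupp.zero_apply, ← this]
  simp only [Basis.equivFun_symm_apply, map_sum, map_smul, LinearMap.sum_apply,
    LinearMap.smul_apply, Finsupp.coe_finsetSum, Finset.sum_apply, Finsupp.smul_apply, smul_eq_mul]
  refine Finset.sum_congr rfl fun a _ => ?_
  rw [Finset.mul_sum]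
  exact Finset.sum_congr rfl fun b _ => by ring

open MvPolynomial in
theorem exists_common_denominator {k L σ τ : Type*} [Field k] [Field L] [Algebra k L] [Fintype τ]
    {x : σ → L} (hx : AlgebraicIndependent k x)
    (c : τ → L) (hc : ∀ i, c i ∈ IntermediateField.adjoin k (Set.range x)) :
    ∃ (r : MvPolynomial σ k) (p : τ → MvPolynomial σ k), r ≠ 0 ∧
      ∀ i, aeval x r * c i = aeval x (p i) := by
  classical
  have h1 : ∀ i, ∃ s p : MvPolynomial σ k, s ≠ 0 ∧ aeval x s * c i = aeval x p := by
    intro i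
    obtain ⟨p, s, hps⟩ := (IntermediateField.mem_adjoin_range_iff k x (c i)).1 (hc i)
    by_cases hs : s = 0
    · exact ⟨1, 0, one_ne_zero, by rw [hps, hs]; simp⟩
    · refine ⟨s, p, hs, ?_⟩
      rw [hps, mul_div_cancel₀]
      exact fun h => hs ((injective_iff_map_eq_zero _).1 hx s h)
  choose s p hs hsp using h1
  refine ⟨∏ i, s i, fun i => (∏ j ∈ Finset.univ.erase i, s j) * p i,
    Finset.prod_ne_zero_iff.2 fun i _ => hs i, fun i => ?_⟩
  rw [map_mul, ← hsp, ← mul_assoc, ← map_mul, Finset.prod_erase_mul _ _ (Finset.mem_univ i)]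

theorem exists_pow_lt_mul_pow (s D : ℕ) : ∃ E : ℕ, 0 < E ∧ (2 * E + D) ^ s < (2 ^ s + 1) * E ^ s := by
  have h1 : Filter.Tendsto (fun E : ℕ => (2 + (D : ℝ) / (E : ℝ)) ^ s) Filter.atTop
      (nhds ((2 + 0) ^ s)) :=
    (tendsto_const_nhds.add (tendsto_const_div_atTop_nhds_zero_nat (D : ℝ))).pow s
  have h2 := (h1.eventually_lt_const (u := (2 : ℝ) ^ s + 1) (by rw [add_zero]; linarith)).and
    (Filter.eventually_gt_atTop 0)
  obtain ⟨E, hE, hE0⟩ := h2.exists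
  refine ⟨E, hE0, ?_⟩
  have hE' : (0 : ℝ) < E := by exact_mod_cast hE0
  have h3 : (2 * (E : ℝ) + D) ^ s = (2 + (D : ℝ) / E) ^ s * (E : ℝ) ^ s := by
    rw [← mul_pow]; congr 1; field_simp
  have h4 : (2 * (E : ℝ) + D) ^ s < (2 ^ s + 1) * (E : ℝ) ^ s := by
    rw [h3]; exact mul_lt_mul_of_pos_right hE (pow_pos hE' s)
  exact_mod_cast h4

universe u
open MvPolynomial in
theorem finrank_restrictDegree {k σ : Type*} [Field k] [Fintype σ] (n : ℕ) :
    Module.finrank k (restrictDegree σ k n) = (n + 1) ^ Fintype.card σ := by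
  classical
  rw [restrictDegree, Module.finrank_eq_nat_card_basis (basisRestrictSupport k _)]
  let e : {s : σ →₀ ℕ | ∀ i, s i ≤ n} ≃ (σ → Fin (n + 1)) :=
    { toFun := fun s i => ⟨s.1 i, Nat.lt_succ_of_le (s.2 i)⟩
      invFun := fun f => ⟨Finsupp.equivFunOnFinite.symm fun i => f i,
        fun i => Nat.le_of_lt_succ (f i).2⟩
      left_inv := fun s => by ext; simp
      right_inv := fun f => by ext; simp }
  rw [Nat.card_congr e]
  simp

open MvPolynomial in
theorem mem_restrictDegree_iff_degreeOf {k σ : Type*} [Field k] {n : ℕ} {p : MvPolynomial σ k} :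
    p ∈ restrictDegree σ k n ↔ ∀ i, degreeOf i p ≤ n := by
  simp only [mem_restrictDegree, degreeOf_le_iff]
  tauto

open MvPolynomial in
theorem mul_mem_restrictDegree {k σ : Type*} [Field k] {n m : ℕ} {p q : MvPolynomial σ k}
    (hp : p ∈ restrictDegree σ k n) (hq : q ∈ restrictDegree σ k m) :
    p * q ∈ restrictDegree σ k (n + m) := by
  rw [mem_restrictDegree_iff_degreeOf] at *
  exact fun i => (degreeOf_mul_le i p q).trans (add_le_add (hp i) (hq i))

open MvPolynomial in
theorem exists_forall_mem_restrictDegree {k σ τ : Type*} [Field k] [Fintype σ] [Fintype τ]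
    (p : τ → MvPolynomial σ k) : ∃ D, ∀ t, p t ∈ restrictDegree σ k D := by
  refine ⟨∑ t, ∑ i, degreeOf i (p t), fun t => mem_restrictDegree_iff_degreeOf.2 fun i => ?_⟩
  exact (Finset.single_le_sum (f := fun i => degreeOf i (p t)) (fun _ _ => Nat.zero_le _)
    (Finset.mem_univ i)).trans (Finset.single_le_sum (f := fun t => ∑ i, degreeOf i (p t))
      (fun _ _ => Nat.zero_le _) (Finset.mem_univ t))

open MvPolynomial Module in
/-- A system of `δ` quadratic forms in `ι × δ` variables over `k[t_1, …, t_s]` has a nontrivial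
zero as soon as `2 ^ s < |ι|`. -/
theorem exists_mvPolynomial_quadratic_zero {k σ ι δ : Type*} [Field k] [IsAlgClosed k] [Fintype σ]
    [Fintype ι] [Fintype δ] [Nonempty δ] (h : 2 ^ Fintype.card σ < Fintype.card ι)
    (p : (ι × δ) → (ι × δ) → δ → MvPolynomial σ k) :
    ∃ g : ι × δ → MvPolynomial σ k, g ≠ 0 ∧ ∀ c, ∑ a, ∑ b, p a b c * g a * g b = 0 := by
  classical
  obtain ⟨D, hD⟩ := exists_forall_mem_restrictDegree
    (fun t : (ι × δ) × (ι × δ) × δ => p t.1 t.2.1 t.2.2)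
  obtain ⟨E, hE, hlt⟩ := exists_pow_lt_mul_pow (Fintype.card σ) D
  obtain ⟨e, rfl⟩ : ∃ e, E = e + 1 := ⟨E - 1, by omega⟩
  let B : (ι × δ → restrictDegree σ k e) →ₗ[k] (ι × δ → restrictDegree σ k e) →ₗ[k]
      (δ → restrictDegree σ k (D + e + e)) := LinearMap.mk₂ k
    (fun z z' c => ⟨∑ a, ∑ b, p a b c * (z a).1 * (z' b).1, Submodule.sum_mem _ fun a _ =>
      Submodule.sum_mem _ fun b _ => mul_mem_restrictDegree (mul_mem_restrictDegree
        (hD ⟨a, b, c⟩) (z a).2) (z' b).2⟩)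
    (fun z₁ z₂ z' => by
      ext1 c; apply Subtype.ext
      simp [mul_add, add_mul, Finset.sum_add_distrib])
    (fun r z z' => by
      ext1 c; apply Subtype.ext
      simp [Finset.smul_sum])
    (fun z₁ z₂ z' => by
      ext1 c; apply Subtype.ext
      simp [mul_add, Finset.sum_add_distrib])
    (fun r z z' => by
      ext1 c; apply Subtype.ext
      simp [Finset.smul_sum])
  obtain ⟨z, hz, hBz⟩ := exists_ne_zero_bilin_self_eq_zero (by
    simp only [Module.finrank_pi_fintype, finrank_restrictDegree, Finset.sum_const,
      Finset.card_univ, Fintype.card_prod, smul_eq_mul]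
    have h1 : (D + e + e + 1) ^ Fintype.card σ ≤ (2 * (e + 1) + D) ^ Fintype.card σ :=
      Nat.pow_le_pow_left (by omega) _
    have h2 : (2 ^ Fintype.card σ + 1) * (e + 1) ^ Fintype.card σ
      ≤ Fintype.card ι * (e + 1) ^ Fintype.card σ := Nat.mul_le_mul_right _ h
    calc _ < Fintype.card δ * (Fintype.card ι * (e + 1) ^ Fintype.card σ) :=
          Nat.mul_lt_mul_of_pos_left (by omega) Fintype.card_pos
      _ = _ := by ring) B
  refine ⟨fun a => (z a).1, fun h0 => hz (funext fun a => Subtype.ext (congrFun h0 a)),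
    fun c => ?_⟩
  exact congrArg Subtype.val (congrFun hBz c)

theorem smul_sum_sum_mul_sum_smul {K A ι δ : Type*} [CommRing K] [CommRing A] [Algebra K A]
    [Fintype ι] [Fintype δ] (r : K) (C : ι → ι → A) (γ : ι × δ → K) (ω : δ → A) :
    r • ∑ a, ∑ b, C a b * (∑ i, γ (a, i) • ω i) * (∑ i, γ (b, i) • ω i) =
      ∑ a : ι × δ, ∑ b : ι × δ, (r * γ a * γ b) • (C a.1 b.1 * ω a.2 * ω b.2) := by
  simp only [Fintype.sum_prod_type, Finset.mul_sum, Finset.sum_mul, Finset.smul_sum]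
  refine Finset.sum_congr rfl fun a _ => ?_
  rw [Finset.sum_comm (γ := δ)]
  refine Finset.sum_congr rfl fun b _ => ?_
  rw [Finset.sum_comm]
  refine Finset.sum_congr rfl fun i _ => Finset.sum_congr rfl fun j _ => ?_
  simp only [Algebra.smul_def, map_mul]
  ring

open MvPolynomial Module in
theorem exists_quadratic_zero_of_finiteDimensional {k K A σ : Type*} {ι : Type u} [Field k]
    [IsAlgClosed k] [Field K] [Field A] [Algebra K A] [FiniteDimensional K A] [Fintype σ]
    (φ : MvPolynomial σ k →+* K) (hφ : Function.Injective φ)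
    (hden : ∀ {τ : Type u} [Fintype τ] (c : τ → K), ∃ (r : MvPolynomial σ k)
      (p : τ → MvPolynomial σ k), r ≠ 0 ∧ ∀ t, φ r * c t = φ (p t))
    [Fintype ι] (h : 2 ^ Fintype.card σ < Fintype.card ι) (C : ι → ι → A) :
    ∃ x : ι → A, x ≠ 0 ∧ ∑ a, ∑ b, C a b * x a * x b = 0 := by
  classical
  let ω := finBasis K A
  have : Nonempty (Fin (finrank K A)) := ⟨⟨0, finrank_pos⟩⟩
  obtain ⟨r, p, hr, hp⟩ := hden
    (fun t : (ι × Fin (finrank K A)) × (ι × Fin (finrank K A)) × Fin (finrank K A) =>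
      ω.repr (C t.1.1 t.2.1.1 * ω t.1.2 * ω t.2.1.2) t.2.2)
  obtain ⟨g, hg, hg0⟩ := exists_mvPolynomial_quadratic_zero h (fun a b c => p (a, b, c))
  refine ⟨fun a => ∑ i, φ (g (a, i)) • ω i, fun h0 => hg ?_, ?_⟩
  · ext1 ⟨a, i⟩
    exact hφ ((Fintype.linearIndependent_iff.1 ω.linearIndependent _ (congrFun h0 a) i).trans
      (map_zero φ).symm)
  · refine (smul_eq_zero.1 (?_ : φ r • _ = (0 : A))).resolve_left
      ((map_ne_zero_iff φ hφ).2 hr)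
    rw [smul_sum_sum_mul_sum_smul (φ r) C (fun a => φ (g a))]
    calc _ = ∑ a : ι × Fin (finrank K A), ∑ b : ι × Fin (finrank K A),
            ∑ c, (φ (p (a, b, c) * g a * g b)) • ω c := by
          refine Finset.sum_congr rfl fun a _ => Finset.sum_congr rfl fun b _ => ?_
          conv_lhs => rw [← ω.sum_repr (C a.1 b.1 * ω a.2 * ω b.2), Finset.smul_sum]
          refine Finset.sum_congr rfl fun c _ => ?_
          rw [smul_smul, map_mul φ, map_mul φ, ← hp]
          congr 1
          ring
      _ = ∑ c, φ (∑ a, ∑ b, p (a, b, c) * g a * g b) • ω c := by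
          simp_rw [map_sum, Finset.sum_smul]
          rw [Finset.sum_comm (s := Finset.univ (α := Fin (finrank K A)))]
          exact Finset.sum_congr rfl fun a _ => Finset.sum_comm
      _ = 0 := by simp [hg0]

open MvPolynomial in
/-- Quadratic forms in more than `2 ^ m` variables over a field of transcendence degree at most `m`
over an algebraically closed field are isotropic. -/
theorem exists_quadratic_zero_of_trdeg_le {k L : Type*} [Field k] [IsAlgClosed k] [Field L]
    [Algebra k L] {m : ℕ}
    (hL : ∀ s : Set L, AlgebraicIndependent k ((↑) : s → L) → Cardinal.mk s ≤ m)
    {ι : Type*} [Fintype ι] (hι : 2 ^ m < Fintype.card ι) (C : ι → ι → L) :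
    ∃ x : ι → L, x ≠ 0 ∧ ∑ a, ∑ b, C a b * x a * x b = 0 := by
  classical
  obtain ⟨s, hs⟩ := exists_isTranscendenceBasis k L
  have hsc := hL s hs.1
  have hsf : s.Finite :=
    Cardinal.lt_aleph0_iff_set_finite.1 (hsc.trans_lt (Cardinal.natCast_lt_aleph0))
  have := hsf.fintype
  have hcard : Fintype.card s ≤ m := by simpa using hsc
  have halg := hs.isAlgebraic_field
  let K := IntermediateField.adjoin k (Set.range ((↑) : s → L))
  let S : Set L := Set.range fun ab : ι × ι => C ab.1 ab.2
  let L0 := IntermediateField.adjoin K S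
  have : Finite S := Set.finite_range _
  have : FiniteDimensional K L0 := IntermediateField.finiteDimensional_adjoin
    fun x _ => (halg.isAlgebraic x).isIntegral
  let y : s → K := fun i => ⟨i, IntermediateField.subset_adjoin k _ ⟨i, rfl⟩⟩
  have hy : ∀ q : MvPolynomial s k, algebraMap K L (aeval y q) = aeval ((↑) : s → L) q :=
    fun q => by rw [← aeval_algebraMap_apply]; rfl
  have hyinj : Function.Injective (aeval y : MvPolynomial s k →ₐ[k] K) := fun q q' h =>
    hs.1 (by rw [← hy, ← hy, h])
  obtain ⟨x, hx, hx0⟩ := exists_quadratic_zero_of_finiteDimensional (A := L0)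
    (aeval y : MvPolynomial s k →ₐ[k] K).toRingHom hyinj (fun {τ} _ c => by
      obtain ⟨r, p, hr, hp⟩ := exists_common_denominator hs.1 (fun t => (c t : L)) fun t => (c t).2
      refine ⟨r, p, hr, fun t => (algebraMap K L).injective ?_⟩
      rw [map_mul]
      exact (congrArg₂ _ (hy r) rfl).trans ((hp t).trans (hy _).symm))
    ((Nat.pow_le_pow_right two_pos hcard).trans_lt hι)
    (fun a b => ⟨C a b, IntermediateField.subset_adjoin K S ⟨(a, b), rfl⟩⟩)
  refine ⟨fun a => x a, fun h0 => hx (funext fun a => Subtype.ext (congrFun h0 a)), ?_⟩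
  have := congrArg Subtype.val hx0
  simpa using this

theorem exists_eq_smul_of_forall_exists_mul_eq {n L : Type*} [Fintype n] [DecidableEq n] [Field L]
    {G G' : Matrix n n L} (hG : G ≠ 0)
    (h : ∀ M : Matrix n n L, ∃ M' : Matrix n n L, M * G = G * M' ∧ M * G' = G' * M') :
    ∃ c : L, G' = c • G := by
  obtain ⟨i, j, hij⟩ : ∃ i j, G i j ≠ 0 := by
    by_contra! h0
    exact hG (Matrix.ext h0)
  choose M' hM hM' using h
  let H : Matrix n n L := Matrix.of fun q p => (G i j)⁻¹ * M' (Matrix.single p i 1) q j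
  have hGH : G * H = 1 := by
    ext q p
    have h1 := congrFun (congrFun (hM (Matrix.single p i 1)) q) j
    have h2 : (G * H) q p = (G i j)⁻¹ * (G * M' (Matrix.single p i 1)) q j := by
      simp only [Matrix.mul_apply, H, Matrix.of_apply, Finset.mul_sum]
      exact Finset.sum_congr rfl fun x _ => by ring
    rw [h2, ← h1, Matrix.one_apply]
    by_cases hqp : q = p
    · subst hqp
      simp [hij]
    · simp [hqp, Matrix.single_mul_apply_of_ne]
  have hHG : H * G = 1 := mul_eq_one_comm.1 hGH
  have hc : ∀ M, Commute (G' * H) M := fun M => by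
    have h1 : M' M = H * M * G := by rw [mul_assoc, hM, ← mul_assoc, hHG, one_mul]
    have h2 : M * G' = G' * H * M * G := by rw [hM', h1]; simp only [mul_assoc]
    change G' * H * M = M * (G' * H)
    rw [← mul_assoc M, h2, mul_assoc _ G, hGH, mul_one]
  obtain ⟨c, hc⟩ := Matrix.mem_range_scalar_of_commute_single (M := G' * H)
    fun p q _ => (hc _).symm
  refine ⟨c, ?_⟩
  calc G' = G' * H * G := by rw [mul_assoc, hHG, mul_one]
    _ = c • G := by rw [← hc, Matrix.scalar_apply, ← Matrix.smul_eq_diagonal_mul]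

/-- A matrix algebra over `L` cannot act `L`-linearly on an `F`-vector space with a bilinear form
with respect to which all matrices have adjoints, if a quadratic form `w ↦ B w (M w)` is
anisotropic while all quadratic forms over `L` of the size of the matrices are isotropic. -/
theorem false_of_matrix_action {L F W n : Type*} [Field L] [Field F] [Algebra L F]
    [AddCommGroup W] [Module F W] [Module L W] [IsScalarTower L F W] [SMulCommClass F L W]
    [Nontrivial W]
    [Fintype n] [DecidableEq n] [Nonempty n] (f : Matrix n n L →ₐ[L] Module.End F W)
    (B : W →ₗ[F] W →ₗ[F] F)
    (hadj : ∀ M, ∃ M', ∀ w w', B (f M w) w' = B w (f M' w'))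
    (M : Matrix n n L) (haniso : ∀ w, B w (f M w) = 0 → w = 0)
    (hiso : ∀ C : n → n → L, ∃ x : n → L, x ≠ 0 ∧ ∑ a, ∑ b, C a b * x a * x b = 0) : False := by
  obtain ⟨i⟩ := ‹Nonempty n›
  obtain ⟨w, hw⟩ : ∃ w, f (Matrix.single i i 1) w ≠ 0 := by
    by_contra! h0
    have h1 : f (Matrix.single i i 1) = 0 := LinearMap.ext h0
    have h2 : ∀ j, f (Matrix.single j j 1) = 0 := fun j => by
      have : (Matrix.single j j 1 : Matrix n n L) =
        Matrix.single j i 1 * Matrix.single i i 1 * Matrix.single i j 1 := by simp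
      rw [this, map_mul, map_mul, h1, mul_zero, zero_mul]
    have h3 : f 1 = 0 := by
      have h4 : (1 : Matrix n n L) = ∑ j, Matrix.single j j 1 := by
        ext p q; simp [Matrix.sum_apply, Matrix.single_apply, Matrix.one_apply, ite_and]
      rw [h4, map_sum, Finset.sum_eq_zero fun j _ => h2 j]
    exact one_ne_zero ((map_one f).symm.trans h3)
  let T : (n → L) →ₗ[L] W :=
    { toFun := fun x => f (Matrix.of fun p q => if q = i then x p else 0) w
      map_add' := fun x y => by
        rw [← LinearMap.add_apply, ← map_add]
        congr 2; ext p q; by_cases h : q = i <;> simp [h]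
      map_smul' := fun r x => by
        rw [RingHom.id_apply, ← LinearMap.smul_apply, ← map_smul]
        congr 2; ext p q; by_cases h : q = i <;> simp [h] }
  have hT : ∀ A x, f A (T x) = T (A.mulVec x) := fun A x => by
    change f A (f _ w) = f _ w
    rw [← Module.End.mul_apply, ← map_mul]
    congr 2; ext p q
    by_cases h : q = i <;> simp [h, Matrix.mul_apply, Matrix.mulVec, dotProduct]
  have hT0 : ∀ x, T x = 0 → x = 0 := fun x hx => by
    ext j
    have h1 : f (Matrix.single i j 1 * Matrix.of fun p q => if q = i then x p else 0) w = 0 := by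
      rw [map_mul, Module.End.mul_apply]
      exact (congrArg _ hx).trans (map_zero _)
    have h2 : (Matrix.single i j 1 * Matrix.of fun p q => if q = i then x p else 0) =
        x j • Matrix.single i i 1 := by
      ext p q
      by_cases hp : p = i
      · subst hp
        by_cases h : q = p
        · simp [h]
        · simp [h, Ne.symm h]
      · rw [Matrix.single_mul_apply_of_ne _ _ _ _ _ hp]
        simp [Ne.symm hp]
    rw [h2, map_smul, LinearMap.smul_apply] at h1
    exact (smul_eq_zero.1 h1).resolve_right hw
  let β : (n → L) → (n → L) → F := fun x y => B (T x) (T y)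
  let Gr : (F →ₗ[L] L) → Matrix n n L := fun l =>
    Matrix.of fun p q => l (β (Pi.single p 1) (Pi.single q 1))
  have hGr : ∀ l x y, l (β x y) = x ⬝ᵥ (Gr l).mulVec y := fun l x y => by
    have hx : ∀ z : n → L, T z = ∑ p, z p • T (Pi.single p 1) := fun z => by
      conv_lhs => rw [pi_eq_sum_univ' z]
      rw [map_sum]
      exact Finset.sum_congr rfl fun p _ => by rw [map_smul]
    have hL : ∀ (r : L) (z : W), r • z = algebraMap L F r • z := fun r z =>
      (algebraMap_smul F r z).symm
    simp only [β]
    rw [hx x, hx y]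
    simp only [map_sum, LinearMap.sum_apply, hL, map_smul, LinearMap.smul_apply, smul_eq_mul,
      dotProduct, Matrix.mulVec, Gr, Matrix.of_apply, Finset.mul_sum, β]
    rw [Finset.sum_comm]
    refine Finset.sum_congr rfl fun p _ => Finset.sum_congr rfl fun q _ => ?_
    rw [← Algebra.smul_def, ← Algebra.smul_def, map_smul, map_smul, smul_eq_mul, smul_eq_mul]
    ring
  have hGadj : ∀ A : Matrix n n L, ∃ A' : Matrix n n L, ∀ l, A * Gr l = Gr l * A' := fun A => by
    obtain ⟨A', hA'⟩ := hadj A.transpose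
    refine ⟨A', fun l => Matrix.ext fun p q => ?_⟩
    have h1 := congrArg l (hA' (T (Pi.single p 1)) (T (Pi.single q 1)))
    rw [hT, hT] at h1
    have h2 := (hGr l _ _).symm.trans (h1.trans (hGr l _ _))
    simpa [Matrix.mul_apply, dotProduct, Matrix.mulVec, Pi.single_apply] using h2
  have hfix : β (Pi.single i 1) (M.mulVec (Pi.single i 1)) ≠ 0 := fun h => by
    have := hT0 _ (haniso (T (Pi.single i 1)) (by rw [hT]; exact h))
    simpa using congrFun this i
  obtain ⟨l, hl⟩ : ∃ l : F →ₗ[L] L, l (β (Pi.single i 1) (M.mulVec (Pi.single i 1))) ≠ 0 := by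
    by_contra! h
    exact hfix ((Module.forall_dual_apply_eq_zero_iff L _).1 h)
  have hGl : Gr l ≠ 0 := fun h => hl (by rw [hGr, h]; simp)
  obtain ⟨x, hx, hx0⟩ := hiso (Gr l * M)
  refine hx (hT0 x (haniso _ ?_))
  rw [hT]
  change β x (M.mulVec x) = 0
  refine (Module.forall_dual_apply_eq_zero_iff L _).1 fun l' => ?_
  obtain ⟨c, hc⟩ := exists_eq_smul_of_forall_exists_mul_eq hGl
    (G' := Gr l') fun A => (hGadj A).imp fun A' h => ⟨h l, h l'⟩
  rw [hGr, hc, Matrix.smul_mulVec, dotProduct_smul, Matrix.mulVec_mulVec]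
  have : x ⬝ᵥ (Gr l * M).mulVec x = ∑ a, ∑ b, (Gr l * M) a b * x a * x b := by
    simp only [dotProduct, Matrix.mulVec, Finset.mul_sum]
    exact Finset.sum_congr rfl fun a _ => Finset.sum_congr rfl fun b _ => by ring
  rw [this, hx0, smul_zero]

open MonomialOrder in
theorem lex_lt_of_apply_zero_lt {n : ℕ} {a b : Fin (n + 1) →₀ ℕ} (h : a 0 < b 0) :
    a ≺[lex] b := by
  rw [lex_lt_iff, Finsupp.Lex.lt_iff]
  exact ⟨0, fun j hj => absurd hj (Fin.not_lt_zero j), h⟩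

open MonomialOrder MvPolynomial in
theorem degree_sq_add_mul_sub {k : Type*} [Field k] {n : ℕ} {p q : MvPolynomial (Fin (n + 1)) k}
    (h : p ≠ 0 ∨ q ≠ 0) :
    p ^ 2 + p * q - X 0 * q ^ 2 ≠ 0 ∧
      ∀ i : Fin n, Even (lex.degree (p ^ 2 + p * q - X 0 * q ^ 2) i.succ) := by
  have hq2 : ∀ {q : MvPolynomial (Fin (n + 1)) k}, q ≠ 0 →
      lex.degree (X 0 * q ^ 2) = Finsupp.single 0 1 + 2 • lex.degree q := fun {q} hq => by
    rw [degree_mul (X_ne_zero _) (pow_ne_zero 2 hq), degree_pow, degree_X]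
  by_cases hq : q = 0
  · subst hq
    have hp : p ≠ 0 := by simpa using h
    simp [hp, degree_pow]
  by_cases hp : p = 0
  · subst hp
    simp only [ne_eq, zero_pow two_ne_zero, zero_mul, zero_add, zero_sub, neg_eq_zero,
      mul_eq_zero, X_ne_zero, pow_eq_zero_iff two_ne_zero, hq, or_self, not_false_eq_true,
      degree_neg, hq2 hq, true_and]
    intro i
    simp
  have hpq : lex.degree (p * q) = lex.degree p + lex.degree q := degree_mul hp hq
  have hp2 : lex.degree (p ^ 2) = 2 • lex.degree p := degree_pow ..
  have key : ∀ a b c : MvPolynomial (Fin (n + 1)) k, lex.degree b ≺[lex] lex.degree a →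
      lex.degree c ≺[lex] lex.degree a → a + b + c ≠ 0 ∧
        lex.degree (a + b + c) = lex.degree a := fun a b c hb hc => by
    have h1 := degree_add_of_lt hb
    have h2 : lex.degree (a + b + c) = lex.degree a := by
      rw [degree_add_of_lt (by rwa [h1]), h1]
    refine ⟨fun h0 => ?_, h2⟩
    rw [h0, degree_zero] at h2
    rw [← h2, map_zero] at hb
    exact absurd hb (not_lt.2 (MonomialOrder.zero_le _ _))
  rcases lt_or_ge (lex.degree q 0) (lex.degree p 0) with hlt | hge
  · have := key (p ^ 2) (p * q) (-(X 0 * q ^ 2))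
      (lex_lt_of_apply_zero_lt (by rw [hpq, hp2]; simp; omega))
      (lex_lt_of_apply_zero_lt (by rw [degree_neg, hq2 hq, hp2]; simp; omega))
    rw [← sub_eq_add_neg] at this
    refine ⟨this.1, fun i => ?_⟩
    rw [this.2, hp2]; simp
  · have := key (-(X 0 * q ^ 2)) (p ^ 2) (p * q)
      (lex_lt_of_apply_zero_lt (by rw [degree_neg, hq2 hq, hp2]; simp; omega))
      (lex_lt_of_apply_zero_lt (by rw [degree_neg, hpq, hq2 hq]; simp; omega))
    rw [show -(X 0 * q ^ 2) + p ^ 2 + p * q = p ^ 2 + p * q - X 0 * q ^ 2 by ring] at this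
    refine ⟨this.1, fun i => ?_⟩
    rw [this.2, degree_neg, hq2 hq]; simp

open MonomialOrder MvPolynomial in
theorem eq_zero_of_sum_prod_X_mul_eq_zero {k : Type*} [Field k] {n : ℕ}
    (p q : Finset (Fin n) → MvPolynomial (Fin (n + 1)) k)
    (h : ∑ S, (∏ i ∈ S, X i.succ) * (p S ^ 2 + p S * q S - X 0 * q S ^ 2) = 0) (S) :
    p S = 0 ∧ q S = 0 := by
  classical
  by_contra hS
  let f : Finset (Fin n) → MvPolynomial (Fin (n + 1)) k :=
    fun S => (∏ i ∈ S, X i.succ) * (p S ^ 2 + p S * q S - X 0 * q S ^ 2)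
  let A := Finset.univ.filter fun S => f S ≠ 0
  have hXne : ∀ S : Finset (Fin n), (∏ i ∈ S, X i.succ : MvPolynomial (Fin (n + 1)) k) ≠ 0 :=
    fun S => Finset.prod_ne_zero_iff.2 fun i _ => X_ne_zero _
  have hpq : ∀ T, f T ≠ 0 → p T ≠ 0 ∨ q T ≠ 0 := fun T hT => by
    by_contra! h0
    exact hT (by simp [f, h0.1, h0.2])
  have hparity : ∀ T, f T ≠ 0 → ∀ i, Even (lex.degree (f T) (Fin.succ i)) ↔ i ∉ T := by
    intro T hT i
    obtain ⟨h1, h2⟩ := degree_sq_add_mul_sub (hpq T hT)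
    have h3 : lex.degree (∏ i ∈ T, X i.succ : MvPolynomial (Fin (n + 1)) k) (Fin.succ i) =
        if i ∈ T then 1 else 0 := by
      rw [degree_prod fun i _ => X_ne_zero _]
      simp [degree_X, Finsupp.single_apply]
    simp only [f]
    rw [degree_mul (hXne T) h1, Finsupp.add_apply, h3, Nat.even_add]
    simp only [h2 i, iff_true]
    split_ifs with h <;> simp [h]
  have hA : A.Nonempty := ⟨S, Finset.mem_filter.2 ⟨Finset.mem_univ _,
    mul_ne_zero (hXne S) (degree_sq_add_mul_sub (by tauto)).1⟩⟩
  obtain ⟨T, hT, hmax⟩ := A.exists_max_image (fun T => lex.toSyn (lex.degree (f T))) hA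
  have hT0 : f T ≠ 0 := (Finset.mem_filter.1 hT).2
  have hcoeff := congrArg (coeff (lex.degree (f T))) h
  rw [coeff_sum, Finset.sum_eq_single T] at hcoeff
  · exact coeff_degree_ne_zero_iff.2 hT0 (hcoeff.trans (coeff_zero _))
  · intro U _ hUT
    by_cases hU : f U = 0
    · change coeff _ (f U) = 0
      rw [hU, coeff_zero]
    · refine coeff_eq_zero_of_lt ((hmax U (Finset.mem_filter.2 ⟨Finset.mem_univ _, hU⟩)).lt_of_ne
        fun heq => hUT ?_)
      ext i
      have := lex.toSyn.injective heq
      rw [← not_iff_not, ← hparity U hU, ← hparity T hT0, this]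
  · simp

/-- The space `K(√Y₁, …, √Y_m)` with `K = F(θ)`, `θ² = X + θ`, written in the basis of square-free
products of the `√Yᵢ`. -/
abbrev RootSpace (F : Type*) [Field F] (m : ℕ) (X : F) : Type _ :=
  Finset (Fin m) → QuadraticAlgebra F X 1

namespace RootSpace

variable {F : Type*} [Field F] {m : ℕ} {X : F}

open QuadraticAlgebra

/-- Multiplication by `θ`. -/
def thetaOp : Module.End F (RootSpace F m X) where
  toFun w S := ω * w S
  map_add' _ _ := funext fun _ => mul_add _ _ _
  map_smul' r w := funext fun S => mul_smul_comm r ω (w S)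

/-- Conjugation of the coefficients. -/
def starOp : Module.End F (RootSpace F m X) where
  toFun w S := star (w S)
  map_add' _ _ := funext fun _ => star_add _ _
  map_smul' r w := funext fun S => by ext <;> simp [mul_add, mul_left_comm]

/-- The projection to the part of odd degree in `√Yᵢ`. -/
def oddOp (i : Fin m) : Module.End F (RootSpace F m X) where
  toFun w S := if i ∈ S then w S else 0
  map_add' _ _ := funext fun S => by by_cases h : i ∈ S <;> simp [h]
  map_smul' _ _ := funext fun S => by by_cases h : i ∈ S <;> simp [h]

/-- Multiplication by `√Yᵢ`. -/
def rootOp (Y : Fin m → F) (i : Fin m) : Module.End F (RootSpace F m X) where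
  toFun w S := (if i ∈ S then 1 else Y i) • w (symmDiff S {i})
  map_add' _ _ := funext fun _ => smul_add _ _ _
  map_smul' r w := funext fun _ => smul_comm _ r (w _)

/-- Multiplication by `√Y₁ ⋯ √Y_m`. -/
def rootProdOp (Y : Fin m → F) : Module.End F (RootSpace F m X) where
  toFun w S := (∏ i ∈ Sᶜ, Y i) • w Sᶜ
  map_add' _ _ := funext fun _ => smul_add _ _ _
  map_smul' r w := funext fun _ => smul_comm _ r (w _)

variable (m X) in
/-- The operators by which the generators `u` of the quaternion algebras act. -/
def uOp : Fin (m + 1) → Module.End F (RootSpace F m X) :=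
  Fin.snoc (fun i => thetaOp + oddOp i) thetaOp

variable (X) in
/-- The operators by which the generators `v` of the quaternion algebras act. -/
def vOp (Y : Fin m → F) : Fin (m + 1) → Module.End F (RootSpace F m X) :=
  Fin.snoc (rootOp Y) (starOp * rootProdOp Y)

theorem mem_symmDiff_singleton {i j : Fin m} {S : Finset (Fin m)} :
    j ∈ symmDiff S {i} ↔ (j ∈ S ↔ j ≠ i) := by
  simp only [Finset.mem_symmDiff, Finset.mem_singleton]; tauto

theorem thetaOp_sq : (thetaOp * thetaOp : Module.End F (RootSpace F m X)) =
    thetaOp + algebraMap F _ X := by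
  refine LinearMap.ext fun w => funext fun S => ?_
  ext <;> simp [thetaOp] <;> ring

theorem oddOp_sq (i : Fin m) : (oddOp i * oddOp i : Module.End F (RootSpace F m X)) = oddOp i := by
  refine LinearMap.ext fun w => funext fun S => ?_
  by_cases h : i ∈ S <;> simp [oddOp, h]

theorem rootOp_sq (Y : Fin m → F) (i : Fin m) :
    (rootOp Y i * rootOp Y i : Module.End F (RootSpace F m X)) = algebraMap F _ (Y i) := by
  refine LinearMap.ext fun w => funext fun S => ?_
  by_cases h : i ∈ S <;> simp [rootOp, h, mem_symmDiff_singleton]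

theorem starOp_sq : (starOp * starOp : Module.End F (RootSpace F m X)) = 1 := by
  refine LinearMap.ext fun w => funext fun S => ?_
  simp [starOp]

theorem rootProdOp_sq (Y : Fin m → F) :
    (rootProdOp Y * rootProdOp Y : Module.End F (RootSpace F m X)) =
      algebraMap F _ (∏ i, Y i) := by
  refine LinearMap.ext fun w => funext fun S => ?_
  simp [rootProdOp, smul_smul, Finset.prod_compl_mul_prod]

theorem commute_thetaOp_oddOp (i : Fin m) :
    Commute (thetaOp : Module.End F (RootSpace F m X)) (oddOp i) :=
  LinearMap.ext fun w => funext fun S => by by_cases h : i ∈ S <;> simp [thetaOp, oddOp, h]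

theorem commute_oddOp_oddOp (i j : Fin m) :
    Commute (oddOp i : Module.End F (RootSpace F m X)) (oddOp j) :=
  LinearMap.ext fun w => funext fun S => by
    by_cases h : i ∈ S <;> by_cases h' : j ∈ S <;> simp [oddOp, h, h']

theorem commute_thetaOp_rootOp (Y : Fin m → F) (i : Fin m) :
    Commute (thetaOp : Module.End F (RootSpace F m X)) (rootOp Y i) :=
  LinearMap.ext fun w => funext fun S => by simp [thetaOp, rootOp]

theorem commute_thetaOp_rootProdOp (Y : Fin m → F) :
    Commute (thetaOp : Module.End F (RootSpace F m X)) (rootProdOp Y) :=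
  LinearMap.ext fun w => funext fun S => by simp [thetaOp, rootProdOp]

theorem starOp_mul_thetaOp :
    (starOp * thetaOp : Module.End F (RootSpace F m X)) = (1 - thetaOp) * starOp := by
  refine LinearMap.ext fun w => funext fun S => ?_
  ext
  · simp [starOp, thetaOp]
  · simp [starOp, thetaOp, sub_eq_add_neg]

theorem commute_starOp_oddOp (i : Fin m) :
    Commute (starOp : Module.End F (RootSpace F m X)) (oddOp i) :=
  LinearMap.ext fun w => funext fun S => by by_cases h : i ∈ S <;> simp [starOp, oddOp, h]

theorem commute_starOp_rootOp (Y : Fin m → F) (i : Fin m) :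
    Commute (starOp : Module.End F (RootSpace F m X)) (rootOp Y i) :=
  LinearMap.ext fun w => funext fun S => by
    by_cases h : i ∈ S <;> ext <;> simp [starOp, rootOp, h] <;> ring

theorem commute_starOp_rootProdOp (Y : Fin m → F) :
    Commute (starOp : Module.End F (RootSpace F m X)) (rootProdOp Y) :=
  LinearMap.ext fun w => funext fun S => by
    ext <;> simp [starOp, rootProdOp] <;> ring

theorem commute_oddOp_rootOp (Y : Fin m → F) {i j : Fin m} (hij : i ≠ j) :
    Commute (oddOp i : Module.End F (RootSpace F m X)) (rootOp Y j) :=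
  LinearMap.ext fun w => funext fun S => by
    by_cases h : i ∈ S <;> simp [oddOp, rootOp, h, mem_symmDiff_singleton, hij]

theorem rootOp_mul_oddOp (Y : Fin m → F) (i : Fin m) :
    (rootOp Y i * oddOp i : Module.End F (RootSpace F m X)) = (1 - oddOp i) * rootOp Y i := by
  refine LinearMap.ext fun w => funext fun S => ?_
  by_cases h : i ∈ S <;> simp [oddOp, rootOp, h, mem_symmDiff_singleton]

theorem rootProdOp_mul_oddOp (Y : Fin m → F) (i : Fin m) :
    (rootProdOp Y * oddOp i : Module.End F (RootSpace F m X)) =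
      (1 - oddOp i) * rootProdOp Y := by
  refine LinearMap.ext fun w => funext fun S => ?_
  by_cases h : i ∈ S <;> simp [oddOp, rootProdOp, h]

theorem commute_rootOp_rootOp (Y : Fin m → F) (i j : Fin m) :
    Commute (rootOp Y i : Module.End F (RootSpace F m X)) (rootOp Y j) := by
  by_cases hij : i = j
  · rw [hij]
  refine LinearMap.ext fun w => funext fun S => ?_
  simp only [rootOp, Module.End.mul_apply, LinearMap.coe_mk, AddHom.coe_mk,
    mem_symmDiff_singleton, smul_smul, symmDiff_assoc, symmDiff_comm {i}]
  simp only [ne_eq, hij, Ne.symm hij, not_false_eq_true, iff_true, mul_comm]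

theorem commute_rootOp_rootProdOp (Y : Fin m → F) (i : Fin m) :
    Commute (rootOp Y i : Module.End F (RootSpace F m X)) (rootProdOp Y) := by
  refine LinearMap.ext fun w => funext fun S => ?_
  have h1 : (symmDiff S {i})ᶜ = symmDiff Sᶜ {i} := by
    ext j; simp only [Finset.mem_compl, mem_symmDiff_singleton]; tauto
  simp only [rootOp, rootProdOp, Module.End.mul_apply, LinearMap.coe_mk, AddHom.coe_mk, smul_smul,
    h1]
  congr 1
  by_cases h : i ∈ S
  · have : symmDiff Sᶜ {i} = insert i Sᶜ := by
      ext j; simp only [mem_symmDiff_singleton, Finset.mem_compl, Finset.mem_insert]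
      by_cases hj : j = i <;> simp [hj, h]
    rw [this, Finset.prod_insert (by simpa using h)]
    simp [h, mul_comm]
  · have : symmDiff Sᶜ {i} = Sᶜ.erase i := by
      ext j; simp only [mem_symmDiff_singleton, Finset.mem_compl, Finset.mem_erase]
      by_cases hj : j = i <;> simp [hj, h]
    rw [this, if_neg h, Finset.mul_prod_erase _ _ (by simpa using h)]
    simp [h]

theorem commute_uOp_uOp (i j : Fin (m + 1)) : Commute (uOp m X i : Module.End F _) (uOp m X j) := by
  have h : ∀ i : Fin m, Commute (uOp m X i.castSucc : Module.End F _) thetaOp := fun i => by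
    simpa [uOp] using (Commute.refl _).add_left (commute_thetaOp_oddOp i).symm
  have h0 : uOp m X (Fin.last m) = (thetaOp : Module.End F _) := by simp [uOp]
  induction i using Fin.lastCases with
  | last =>
    induction j using Fin.lastCases with
    | last => exact Commute.refl _
    | cast j => rw [h0]; exact (h j).symm
  | cast i =>
    induction j using Fin.lastCases with
    | last => rw [h0]; exact h i
    | cast j =>
      have h1 : uOp m X j.castSucc = (thetaOp + oddOp j : Module.End F _) := by simp [uOp]
      have h2 : uOp m X i.castSucc = (thetaOp + oddOp i : Module.End F _) := by simp [uOp]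
      rw [h1]
      refine (h i).add_right ?_
      rw [h2]
      exact (commute_thetaOp_oddOp j).add_left (commute_oddOp_oddOp i j)

theorem commute_vOp_vOp (Y : Fin m → F) (i j : Fin (m + 1)) :
    Commute (vOp X Y i) (vOp X Y j) := by
  induction i using Fin.lastCases with
  | last =>
    induction j using Fin.lastCases with
    | last => exact Commute.refl _
    | cast j =>
      simpa [vOp] using (commute_starOp_rootOp Y j).mul_left (commute_rootOp_rootProdOp Y j).symm
  | cast i =>
    induction j using Fin.lastCases with
    | last =>
      simpa [vOp] using
        ((commute_starOp_rootOp Y i).mul_left (commute_rootOp_rootProdOp Y i).symm).symm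
    | cast j => simpa [vOp] using commute_rootOp_rootOp Y i j

theorem vOp_sq (Y : Fin m → F) (i : Fin (m + 1)) :
    vOp X Y i * vOp X Y i =
      algebraMap F _ ((Fin.snoc Y (∏ i, Y i) : Fin (m + 1) → F) i) := by
  induction i using Fin.lastCases with
  | last =>
    simp only [vOp, Fin.snoc_last]
    rw [(commute_starOp_rootProdOp Y).symm.mul_mul_mul_comm, starOp_sq, rootProdOp_sq, one_mul]
  | cast i => simp [vOp, rootOp_sq]

theorem end_neg_eq [CharP F 2] (a : Module.End F (RootSpace F m X)) : -a = a := by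
  rw [neg_eq_iff_add_eq_zero, ← two_smul F a, CharTwo.two_eq_zero, zero_smul]

variable [CharP F 2]

theorem uOp_sq (i : Fin (m + 1)) : uOp m X i * uOp m X i - uOp m X i = algebraMap F _ X := by
  induction i using Fin.lastCases with
  | last => simp [uOp, thetaOp_sq]
  | cast i =>
    have h : (thetaOp * oddOp i + oddOp i * thetaOp : Module.End F (RootSpace F m X)) = 0 := by
      rw [(commute_thetaOp_oddOp i).eq, ← neg_eq_iff_add_eq_zero, end_neg_eq]
    simp only [uOp, Fin.snoc_castSucc]
    calc _ = thetaOp * thetaOp + (thetaOp * oddOp i + oddOp i * thetaOp) + oddOp i * oddOp i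
          - (thetaOp + oddOp i) := by noncomm_ring
      _ = _ := by rw [h, thetaOp_sq, oddOp_sq]; abel

theorem vOp_mul_uOp (Y : Fin m → F) (i : Fin (m + 1)) :
    vOp X Y i * uOp m X i = (1 - uOp m X i) * vOp X Y i := by
  induction i using Fin.lastCases with
  | last =>
    simp only [vOp, uOp, Fin.snoc_last]
    rw [mul_assoc, ← (commute_thetaOp_rootProdOp Y).eq, ← mul_assoc, starOp_mul_thetaOp, mul_assoc]
  | cast i =>
    simp only [vOp, uOp, Fin.snoc_castSucc]
    rw [mul_add, rootOp_mul_oddOp, ← (commute_thetaOp_rootOp Y i).eq, ← add_mul,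
      ← sub_sub, sub_eq_add_neg 1 thetaOp, end_neg_eq]
    congr 1; abel

theorem commute_uOp_vOp (Y : Fin m → F) {i j : Fin (m + 1)} (hij : i ≠ j) :
    Commute (uOp m X i) (vOp X Y j) := by
  induction i using Fin.lastCases with
  | last =>
    induction j using Fin.lastCases with
    | last => exact absurd rfl hij
    | cast j => simpa [uOp, vOp] using commute_thetaOp_rootOp Y j
  | cast i =>
    induction j using Fin.lastCases with
    | last =>
      simp only [uOp, vOp, Fin.snoc_castSucc, Fin.snoc_last]
      have h1 : (starOp * rootProdOp Y : Module.End F (RootSpace F m X)) * thetaOp =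
          (1 - thetaOp) * (starOp * rootProdOp Y) := by
        rw [mul_assoc, ← (commute_thetaOp_rootProdOp Y).eq, ← mul_assoc, starOp_mul_thetaOp,
          mul_assoc]
      have h2 : (starOp * rootProdOp Y : Module.End F (RootSpace F m X)) * oddOp i =
          (1 - oddOp i) * (starOp * rootProdOp Y) := by
        rw [mul_assoc, rootProdOp_mul_oddOp, sub_mul, mul_sub, sub_mul, one_mul, one_mul,
          ← mul_assoc, (commute_starOp_oddOp i).eq, mul_assoc]
      refine Eq.symm ?_
      have h0 : (1 + 1 : Module.End F (RootSpace F m X)) = 0 := by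
        rw [← neg_eq_iff_add_eq_zero, end_neg_eq]
      rw [mul_add, h1, h2, ← add_mul, sub_add_sub_comm, h0, zero_sub, end_neg_eq]
    | cast j =>
      simp only [uOp, vOp, Fin.snoc_castSucc]
      exact (commute_thetaOp_rootOp Y j).add_left
        (commute_oddOp_rootOp Y fun h => hij (congrArg _ h))

end RootSpace

namespace RootSpace

variable {F : Type*} [Field F] {m : ℕ} {X : F}

open QuadraticAlgebra

/-- The trace form of `RootSpace F m X`, diagonal with weights `Y^S`. -/
def form (Y : Fin m → F) :
    RootSpace F m X →ₗ[F] RootSpace F m X →ₗ[F] F :=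
  LinearMap.mk₂ F (fun w w' => ∑ S, (∏ i ∈ S, Y i) *
      (2 * ((w S).re * (w' S).re) + (w S).re * (w' S).im + (w S).im * (w' S).re
        - 2 * X * ((w S).im * (w' S).im)))
    (fun w₁ w₂ w' => by
      rw [← Finset.sum_add_distrib]
      exact Finset.sum_congr rfl fun S _ => by simp; ring)
    (fun r w w' => by
      rw [Finset.smul_sum]
      exact Finset.sum_congr rfl fun S _ => by simp; ring)
    (fun w w₁ w₂ => by
      rw [← Finset.sum_add_distrib]
      exact Finset.sum_congr rfl fun S _ => by simp; ring)
    (fun r w w' => by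
      rw [Finset.smul_sum]
      exact Finset.sum_congr rfl fun S _ => by simp; ring)

theorem form_apply (Y : Fin m → F) (w w' : RootSpace F m X) :
    form Y w w' = ∑ S, (∏ i ∈ S, Y i) *
      (2 * ((w S).re * (w' S).re) + (w S).re * (w' S).im + (w S).im * (w' S).re
        - 2 * X * ((w S).im * (w' S).im)) := rfl

theorem form_comm (Y : Fin m → F) (w w' : RootSpace F m X) :
    form Y w w' = form Y w' w := by
  rw [form_apply, form_apply]
  refine Finset.sum_congr rfl fun S _ => ?_
  ring

theorem form_thetaOp_left (Y : Fin m → F) (w w' : RootSpace F m X) :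
    form Y (thetaOp w) w' = form Y w ((1 - thetaOp : Module.End F _) w') := by
  rw [form_apply, form_apply]
  refine Finset.sum_congr rfl fun S _ => ?_

  congr 1
  simp [thetaOp]; ring

theorem form_oddOp_left (Y : Fin m → F) (i : Fin m) (w w' : RootSpace F m X) :
    form Y (oddOp i w) w' = form Y w (oddOp i w') := by
  rw [form_apply, form_apply]
  refine Finset.sum_congr rfl fun S _ => ?_
  by_cases h : i ∈ S <;> simp [oddOp, h]

theorem form_starOp_left (Y : Fin m → F) (w w' : RootSpace F m X) :
    form Y (starOp w) w' = form Y w (starOp w') := by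
  rw [form_apply, form_apply]
  refine Finset.sum_congr rfl fun S _ => ?_

  congr 1
  simp [starOp]; ring

theorem prod_symmDiff_singleton (Y : Fin m → F) (i : Fin m) (S : Finset (Fin m)) :
    (∏ j ∈ symmDiff S {i}, Y j) * (if i ∈ S then Y i else 1) =
      (∏ j ∈ S, Y j) * (if i ∈ S then 1 else Y i) := by
  by_cases h : i ∈ S
  · have : symmDiff S {i} = S.erase i := by
      ext j; simp only [mem_symmDiff_singleton, Finset.mem_erase]
      by_cases hj : j = i <;> simp [hj, h]
    rw [this, if_pos h, Finset.prod_erase_mul _ _ h, if_pos h, mul_one]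
  · have : symmDiff S {i} = insert i S := by
      ext j; simp only [mem_symmDiff_singleton, Finset.mem_insert]
      by_cases hj : j = i <;> simp [hj, h]
    rw [this, Finset.prod_insert h, if_neg h, if_neg h, mul_one, mul_comm]

theorem form_rootOp_left (Y : Fin m → F) (i : Fin m) (w w' : RootSpace F m X) :
    form Y (rootOp Y i w) w' = form Y w (rootOp Y i w') := by
  rw [form_apply, form_apply]
  have hs : Function.Involutive fun S : Finset (Fin m) => symmDiff S {i} := fun S =>
    symmDiff_symmDiff_cancel_right _ _
  refine Fintype.sum_equiv (Function.Involutive.toPerm (fun S => symmDiff S {i}) hs) _ _ fun S => ?_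
  have h := prod_symmDiff_singleton Y i S
  have hi : i ∈ symmDiff S {i} ↔ i ∉ S := by simp [mem_symmDiff_singleton]
  simp only [rootOp, LinearMap.coe_mk, AddHom.coe_mk, Function.Involutive.coe_toPerm,
    hi, hs S, re_smul, im_smul, smul_eq_mul, ite_not]
  linear_combination -(2 * ((w (symmDiff S {i})).re * (w' S).re) +
    (w (symmDiff S {i})).re * (w' S).im + (w (symmDiff S {i})).im * (w' S).re
        - 2 * X * ((w (symmDiff S {i})).im * (w' S).im)) * h

theorem form_rootProdOp_left (Y : Fin m → F) (w w' : RootSpace F m X) :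
    form Y (rootProdOp Y w) w' = form Y w (rootProdOp Y w') := by
  rw [form_apply, form_apply]
  refine Fintype.sum_equiv (compl_involutive (α := Finset (Fin m))).toPerm _ _ fun S => ?_
  simp only [rootProdOp, LinearMap.coe_mk, AddHom.coe_mk, Function.Involutive.coe_toPerm,
    compl_compl, re_smul, im_smul, smul_eq_mul]
  ring

section

variable [CharP F 2]

theorem form_uOp_left (Y : Fin m → F) (i : Fin (m + 1)) (w w' : RootSpace F m X) :
    form Y (uOp m X i w) w' = form Y w ((1 - uOp m X i) w') := by
  induction i using Fin.lastCases with
  | last => simpa [uOp] using form_thetaOp_left Y w w'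
  | cast i =>
    have h : (1 - (thetaOp + oddOp i) : Module.End F (RootSpace F m X)) =
        (1 - thetaOp) + oddOp i := by
      rw [← sub_sub, sub_eq_add_neg _ (oddOp i), end_neg_eq]
    simp only [uOp, Fin.snoc_castSucc]
    rw [h, LinearMap.add_apply, LinearMap.add_apply, map_add, map_add, LinearMap.add_apply,
      form_thetaOp_left, form_oddOp_left]

omit [CharP F 2] in
theorem form_vOp_left (Y : Fin m → F) (i : Fin (m + 1)) (w w' : RootSpace F m X) :
    form Y (vOp X Y i w) w' = form Y w (vOp X Y i w') := by
  induction i using Fin.lastCases with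
  | last =>
    simp only [vOp, Fin.snoc_last]
    rw [Module.End.mul_apply, form_starOp_left, form_rootProdOp_left,
      (commute_starOp_rootProdOp Y).eq, Module.End.mul_apply]
  | cast i => simpa [vOp] using form_rootOp_left Y i w w'

theorem form_uOp_last_self (Y : Fin m → F) (w : RootSpace F m X) :
    form Y w (uOp m X (Fin.last m) w) =
      ∑ S, (∏ i ∈ S, Y i) * ((w S).re ^ 2 + (w S).re * (w S).im - X * (w S).im ^ 2) := by
  rw [form_apply]
  refine Finset.sum_congr rfl fun S _ => ?_
  have h2 : (2 : F) = 0 := CharTwo.two_eq_zero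
  simp only [uOp, Fin.snoc_last, thetaOp, LinearMap.coe_mk, AddHom.coe_mk,
    re_mul, im_mul, omega_re, omega_im]
  congr 1
  linear_combination ((w S).re * (w S).im * X - X * ((w S).im * ((w S).re + (w S).im)) + X * (w S).im ^2) * h2

end

end RootSpace

namespace RootSpace

open MvPolynomial in
theorem eq_zero_of_sum_normForm_eq_zero {k : Type*} [Field k] {m : ℕ}
    {w : RootSpace (RatFunc' k m) m (Xvar k m)}
    (h : ∑ S, (∏ i ∈ S, Yvar k m i) *
      ((w S).re ^ 2 + (w S).re * (w S).im - Xvar k m * (w S).im ^ 2) = 0) : w = 0 := by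
  have : IsFractionRing (MvPolynomial (Fin (m + 1)) k) (RatFunc' k m) :=
    inferInstanceAs (IsFractionRing (MvPolynomial (Fin (m + 1)) k)
      (FractionRing (MvPolynomial (Fin (m + 1)) k)))
  obtain ⟨b, hb⟩ := IsLocalization.exist_integer_multiples
    (nonZeroDivisors (MvPolynomial (Fin (m + 1)) k)) Finset.univ
    (Sum.elim (fun S => (w S).re) fun S => (w S).im)
  have hb0 : algebraMap _ (RatFunc' k m) (b : MvPolynomial (Fin (m + 1)) k) ≠ 0 :=
    IsFractionRing.to_map_ne_zero_of_mem_nonZeroDivisors b.2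
  choose p hp using fun S => hb (Sum.inl S) (Finset.mem_univ _)
  choose q hq using fun S => hb (Sum.inr S) (Finset.mem_univ _)
  simp only [Sum.elim_inl, Sum.elim_inr, Algebra.smul_def] at hp hq
  have key : ∑ S, (∏ i ∈ S, X i.succ) * (p S ^ 2 + p S * q S - X 0 * q S ^ 2) = 0 := by
    apply IsFractionRing.injective (MvPolynomial (Fin (m + 1)) k) (RatFunc' k m)
    rw [map_zero, ← mul_zero (algebraMap _ (RatFunc' k m) (b : MvPolynomial (Fin (m + 1)) k) ^ 2),
      ← h, Finset.mul_sum, map_sum]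
    refine Finset.sum_congr rfl fun S _ => ?_
    simp only [map_mul, map_sub, map_add, map_pow, map_prod, hp, hq, Xvar, Yvar]
    ring
  refine funext fun S => ?_
  obtain ⟨h1, h2⟩ := eq_zero_of_sum_prod_X_mul_eq_zero p q key S
  have h3 := hp S
  have h4 := hq S
  rw [h1, map_zero, eq_comm, mul_eq_zero, or_iff_right hb0] at h3
  rw [h2, map_zero, eq_comm, mul_eq_zero, or_iff_right hb0] at h4
  exact QuadraticAlgebra.ext h3 h4

end RootSpace

namespace QuatAlg

variable {F : Type*} [Field F]

section

variable (a b : F)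

/-- The quotient map from the free algebra. -/
def mk : FreeAlgebra F (Fin 2) →ₐ[F] QuatAlg F a b :=
  RingQuot.mkAlgHom F (QuatRel F a b)

/-- The generator `u` of `[a,b)_F`. -/
def u : QuatAlg F a b := mk a b (FreeAlgebra.ι F 0)

/-- The generator `v` of `[a,b)_F`. -/
def v : QuatAlg F a b := mk a b (FreeAlgebra.ι F 1)

theorem mk_surjective : Function.Surjective (mk a b) :=
  RingQuot.mkAlgHom_surjective F _

theorem u_mul_u : u a b * u a b = u a b + algebraMap F _ a := by
  have h : mk a b _ = mk a b _ := RingQuot.mkAlgHom_rel F (QuatRel.u_sq (a := a) (b := b))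
  rw [map_sub, map_mul, AlgHom.commutes, sub_eq_iff_eq_add'] at h
  exact h

theorem v_mul_v : v a b * v a b = algebraMap F _ b := by
  have h : mk a b _ = mk a b _ := RingQuot.mkAlgHom_rel F (QuatRel.v_sq (a := a) (b := b))
  rwa [map_mul, AlgHom.commutes] at h

theorem v_mul_u : v a b * u a b = (1 - u a b) * v a b := by
  have h : mk a b _ = mk a b _ := RingQuot.mkAlgHom_rel F (QuatRel.vu (a := a) (b := b))
  rwa [map_mul, map_mul, map_sub, map_one] at h

theorem adjoin_eq_top : Algebra.adjoin F {u a b, v a b} = ⊤ := by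
  have h : Set.range (FreeAlgebra.ι F : Fin 2 → _) = {FreeAlgebra.ι F 0, FreeAlgebra.ι F 1} := by
    ext x; simp [Fin.exists_fin_two, eq_comm]
  rw [← (AlgHom.range_eq_top _).2 (mk_surjective a b), ← Algebra.map_top,
    ← FreeAlgebra.adjoin_range_ι, AlgHom.map_adjoin, h, Set.image_pair]
  rfl

/-- The universal property of `[a,b)_F`. -/
def lift {a b : F} {A : Type*} [Ring A] [Algebra F A] (x y : A) (hx : x * x - x = algebraMap F A a)
    (hy : y * y = algebraMap F A b) (hyx : y * x = (1 - x) * y) : QuatAlg F a b →ₐ[F] A :=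
  RingQuot.liftAlgHom F ⟨FreeAlgebra.lift F ![x, y], fun _ _ h => by
    cases h <;> simpa⟩

section lift

variable {a b} {A : Type*} [Ring A] [Algebra F A] {x y : A} (hx : x * x - x = algebraMap F A a)
    (hy : y * y = algebraMap F A b) (hyx : y * x = (1 - x) * y)

@[simp] theorem lift_u : lift x y hx hy hyx (u a b) = x := by
  refine (RingQuot.liftAlgHom_mkAlgHom_apply F _ _ _).trans ?_
  simp

@[simp] theorem lift_v : lift x y hx hy hyx (v a b) = y := by
  refine (RingQuot.liftAlgHom_mkAlgHom_apply F _ _ _).trans ?_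
  simp

end lift

/-- The family spanning `[a,b)_F`. -/
def spanning : Fin 4 → QuatAlg F a b := ![1, u a b, v a b, u a b * v a b]

theorem span_spanning : Submodule.span F (Set.range (spanning a b)) = ⊤ := by
  set S := Submodule.span F (Set.range (spanning a b)) with hS
  have h1 : 1 ∈ S := Submodule.subset_span ⟨0, rfl⟩
  have hu : u a b ∈ S := Submodule.subset_span ⟨1, rfl⟩
  have hv : v a b ∈ S := Submodule.subset_span ⟨2, rfl⟩
  have huv : u a b * v a b ∈ S := Submodule.subset_span ⟨3, rfl⟩
  have hspan : ∀ x, (∀ i, x * spanning a b i ∈ S) → ∀ y ∈ S, x * y ∈ S := fun x hx y hy => by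
    induction hy using Submodule.span_induction with
    | mem y hy => obtain ⟨i, rfl⟩ := hy; exact hx i
    | zero => simp
    | add y z _ _ hy hz => rw [mul_add]; exact S.add_mem hy hz
    | smul c y _ hy => rw [mul_smul_comm]; exact S.smul_mem c hy
  have hmul : ∀ x y, y ∈ S → x * y ∈ S := fun x => by
    have hx : x ∈ Algebra.adjoin F {u a b, v a b} := adjoin_eq_top a b ▸ Algebra.mem_top
    induction hx using Algebra.adjoin_induction with
    | mem x hx =>
      refine hspan x ?_
      rcases hx with rfl | rfl
      · intro i
        fin_cases i
        · simpa [spanning]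
        · simpa [spanning, u_mul_u, Algebra.algebraMap_eq_smul_one] using
            S.add_mem hu (S.smul_mem a h1)
        · simpa [spanning]
        · simpa [spanning, ← mul_assoc, u_mul_u, add_mul, ← Algebra.smul_def] using
            S.add_mem huv (S.smul_mem a hv)
      · intro i
        fin_cases i
        · simpa [spanning]
        · simpa [spanning, v_mul_u, sub_mul] using S.sub_mem hv huv
        · simpa [spanning, v_mul_v, Algebra.algebraMap_eq_smul_one] using S.smul_mem b h1
        · have : v a b * (u a b * v a b) = b • 1 - b • u a b := by
            rw [← mul_assoc, v_mul_u, mul_assoc, v_mul_v, ← Algebra.commutes, ← Algebra.smul_def,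
              smul_sub]
          simpa [spanning, this] using S.sub_mem (S.smul_mem b h1) (S.smul_mem b hu)
    | algebraMap r => exact fun y hy => by rw [← Algebra.smul_def]; exact S.smul_mem r hy
    | add x y _ _ hx hy => exact fun z hz => by rw [add_mul]; exact S.add_mem (hx z hz) (hy z hz)
    | mul x y _ _ hx hy => exact fun z hz => by rw [mul_assoc]; exact hx _ (hy z hz)
  exact Submodule.eq_top_iff'.2 fun x => by simpa using hmul x 1 h1

instance : Module.Finite F (QuatAlg F a b) :=
  ⟨span_spanning a b ▸ Submodule.fg_span (Set.finite_range _)⟩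

theorem finrank_le : Module.finrank F (QuatAlg F a b) ≤ 4 := by
  have h := finrank_range_le_card (R := F) (spanning a b)
  rwa [Set.finrank, span_spanning, finrank_top, Fintype.card_fin] at h

theorem exists_eq (x : QuatAlg F a b) : ∃ c₀ c₁ c₂ c₃ : F,
    x = algebraMap F _ c₀ + c₁ • u a b + c₂ • v a b + c₃ • (u a b * v a b) := by
  have hx : x ∈ Submodule.span F (Set.range (spanning a b)) :=
    span_spanning a b ▸ Submodule.mem_top
  obtain ⟨c, rfl⟩ := (Submodule.mem_span_range_iff_exists_fun F).1 hx
  refine ⟨c 0, c 1, c 2, c 3, ?_⟩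
  rw [Algebra.algebraMap_eq_smul_one]
  simp [Fin.sum_univ_four, spanning]

end

end QuatAlg

namespace PiTensorProduct

variable {ι R : Type*} [Fintype ι] [DecidableEq ι] [CommRing R] {A : ι → Type*} [∀ i, Ring (A i)]
  [∀ i, Algebra R (A i)] {S : Type*} [Ring S] [Algebra R S]

/-- The product of pairwise commuting algebra homomorphisms, as a homomorphism of monoids. -/
def commuteProd (φ : ∀ i, A i →ₐ[R] S)
    (hφ : Pairwise fun i j => ∀ x y, Commute (φ i x) (φ j y)) : (∀ i, A i) →* S :=
  MonoidHom.noncommPiCoprod (fun i => (φ i : A i →* S)) hφ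

omit [DecidableEq ι] in
theorem commuteProd_mulSingle [DecidableEq ι] (φ : ∀ i, A i →ₐ[R] S)
    (hφ : Pairwise fun i j => ∀ x y, Commute (φ i x) (φ j y)) (i : ι) (a : A i) :
    commuteProd φ hφ (Pi.mulSingle i a) = φ i a :=
  MonoidHom.noncommPiCoprod_mulSingle (ϕ := fun i => (φ i : A i →* S)) (hcomm := hφ) i a

omit [DecidableEq ι] in
theorem commuteProd_update [DecidableEq ι] (φ : ∀ i, A i →ₐ[R] S)
    (hφ : Pairwise fun i j => ∀ x y, Commute (φ i x) (φ j y)) (x : ∀ i, A i) (i : ι) (a : A i) :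
    commuteProd φ hφ (Function.update x i a) =
      φ i a * commuteProd φ hφ (Function.update x i 1) := by
  have h : Function.update x i a = Pi.mulSingle i a * Function.update x i 1 := by
    funext j
    by_cases hj : j = i
    · subst hj; simp
    · simp [hj]
  rw [h, map_mul, commuteProd_mulSingle]

/-- Pairwise commuting algebra homomorphisms induce a homomorphism on the tensor product. -/
noncomputable def liftCommute (φ : ∀ i, A i →ₐ[R] S)
    (hφ : Pairwise fun i j => ∀ x y, Commute (φ i x) (φ j y)) : (⨂[R] i, A i) →ₐ[R] S :=
  liftAlgHom
    { toFun := commuteProd φ hφ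
      map_update_add' := fun x i a b => by
        rw [commuteProd_update φ hφ x i (a + b), map_add, add_mul, ← commuteProd_update,
          ← commuteProd_update]
      map_update_smul' := fun x i c a => by
        rw [commuteProd_update φ hφ x i (c • a), map_smul, smul_mul_assoc, ← commuteProd_update] }
    (map_one (commuteProd φ hφ)) (map_mul (commuteProd φ hφ))

theorem liftCommute_singleAlgHom (φ : ∀ i, A i →ₐ[R] S)
    (hφ : Pairwise fun i j => ∀ x y, Commute (φ i x) (φ j y)) (i : ι) (a : A i) :
    liftCommute φ hφ (singleAlgHom i a) = φ i a := by
  simp only [liftCommute, singleAlgHom_apply, liftAlgHom_apply, lift.tprod]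
  exact commuteProd_mulSingle φ hφ i a

theorem iSup_range_singleAlgHom :
    ⨆ i, (singleAlgHom (R := R) (A := A) i).range = ⊤ := by
  rw [eq_top_iff]
  intro z _
  induction z using PiTensorProduct.induction_on with
  | smul_tprod r x =>
    refine Subalgebra.smul_mem _ ?_ r
    have h := congrArg (tprodMonoidHom R (A := A)) (Finset.noncommProd_mulSingle x)
    replace h := (Finset.map_noncommProd Finset.univ (fun i => Pi.mulSingle i (x i))
      (fun i _ j _ _ => Pi.mulSingle_apply_commute x i j) (tprodMonoidHom R (A := A))).symm.trans h
    rw [show tprod R x = _ from h.symm]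
    refine Submonoid.noncommProd_mem (Subalgebra.toSubsemiring _).toSubmonoid _ _ _ fun i _ => ?_
    exact le_iSup (fun i => (singleAlgHom (R := R) (A := A) i).range) i ⟨x i, rfl⟩
  | add x y hx hy => exact add_mem (hx trivial) (hy trivial)

end PiTensorProduct

theorem Module.finrank_piTensorProduct {ι R : Type*} [Fintype ι] [DecidableEq ι] [Field R] {M : ι → Type*}
    [∀ i, AddCommGroup (M i)] [∀ i, Module R (M i)] [∀ i, Module.Finite R (M i)] :
    Module.finrank R (PiTensorProduct R M) = ∏ i, Module.finrank R (M i) := by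
  rw [Module.finrank_eq_card_basis (Basis.piTensorProduct fun i => Module.finBasis R (M i)),
    Fintype.card_pi]
  simp

namespace RootSpace

variable {F : Type*} [Field F] {m : ℕ} {X : F}

open QuadraticAlgebra

/-- Translation of the exponents. -/
def shiftOp (D : Finset (Fin m)) : Module.End F (RootSpace F m X) where
  toFun w S := w (symmDiff S D)
  map_add' _ _ := rfl
  map_smul' _ _ := rfl

/-- The projection to the exponents that agree with `S` on `D`. -/
def projOp (S D : Finset (Fin m)) : Module.End F (RootSpace F m X) where
  toFun w T := if ∀ i ∈ D, (i ∈ T ↔ i ∈ S) then w T else 0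
  map_add' _ _ := funext fun T => by
    simp only [Pi.add_apply]
    split_ifs
    exacts [rfl, (add_zero 0).symm]
  map_smul' r _ := funext fun T => by
    simp only [Pi.smul_apply, RingHom.id_apply]
    split_ifs
    exacts [rfl, (smul_zero r).symm]

theorem projOp_univ_apply (S : Finset (Fin m)) (w : RootSpace F m X) (T : Finset (Fin m)) :
    projOp S Finset.univ w T = if T = S then w T else 0 := by
  simp [projOp, Finset.ext_iff]

theorem shiftOp_mem {A : Subalgebra F (Module.End F (RootSpace F m X))} {Y : Fin m → F}
    (hY : ∀ i, Y i ≠ 0) (hodd : ∀ i, oddOp i ∈ A) (hroot : ∀ i, rootOp Y i ∈ A)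
    (D : Finset (Fin m)) : shiftOp D ∈ A := by
  induction D using Finset.induction_on with
  | empty =>
    convert A.one_mem
    refine LinearMap.ext fun w => funext fun S => ?_
    simp [shiftOp, ← Finset.bot_eq_empty]
  | insert i D hi ih =>
    have h : shiftOp (insert i D) = (oddOp i + (Y i)⁻¹ • (1 - oddOp i)) * rootOp Y i *
        (shiftOp D : Module.End F (RootSpace F m X)) := by
      refine LinearMap.ext fun w => funext fun S => ?_
      have h1 : symmDiff S (insert i D) = symmDiff (symmDiff S {i}) D := by
        rw [symmDiff_assoc]; congr 1
        ext j
        simp only [Finset.mem_symmDiff, Finset.mem_insert, Finset.mem_singleton]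
        by_cases hj : j = i
        · subst hj; simp [hi]
        · simp [hj]
      by_cases hS : i ∈ S <;> simp [shiftOp, oddOp, rootOp, hS, h1, smul_smul, hY i]
    rw [h]
    exact A.mul_mem (A.mul_mem (A.add_mem (hodd i) (A.smul_mem (A.sub_mem A.one_mem (hodd i)) _))
      (hroot i)) ih

theorem projOp_mem {A : Subalgebra F (Module.End F (RootSpace F m X))}
    (hodd : ∀ i, oddOp i ∈ A) (S D : Finset (Fin m)) : projOp S D ∈ A := by
  induction D using Finset.induction_on with
  | empty =>
    convert A.one_mem
    refine LinearMap.ext fun w => funext fun S => ?_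
    simp [projOp]
  | insert i D hi ih =>
    have h : projOp S (insert i D) = (if i ∈ S then oddOp i else 1 - oddOp i) *
        (projOp S D : Module.End F (RootSpace F m X)) := by
      refine LinearMap.ext fun w => funext fun T => ?_
      by_cases hS : i ∈ S <;> by_cases hT : i ∈ T <;> simp [projOp, oddOp, hS, hT]
    rw [h]
    refine A.mul_mem ?_ ih
    split_ifs
    exacts [hodd i, A.sub_mem A.one_mem (hodd i)]

theorem rootProdOp_mem {A : Subalgebra F (Module.End F (RootSpace F m X))} {Y : Fin m → F}
    (hY : ∀ i, Y i ≠ 0) (hodd : ∀ i, oddOp i ∈ A) (hroot : ∀ i, rootOp Y i ∈ A) :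
    rootProdOp Y ∈ A := by
  have h : rootProdOp Y = ∑ S : Finset (Fin m), (∏ i ∈ Sᶜ, Y i) • (projOp S Finset.univ *
      shiftOp Finset.univ : Module.End F (RootSpace F m X)) := by
    refine LinearMap.ext fun w => funext fun S => ?_
    have hS : symmDiff S Finset.univ = Sᶜ := by ext; simp [Finset.mem_symmDiff]
    simp [LinearMap.sum_apply, projOp_univ_apply, rootProdOp, shiftOp, hS]
  rw [h]
  exact A.sum_mem fun S _ => A.smul_mem
    (A.mul_mem (projOp_mem hodd _ _) (shiftOp_mem hY hodd hroot _)) _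

theorem eq_top_of_mem [CharP F 2] {A : Subalgebra F (Module.End F (RootSpace F m X))}
    (htheta : thetaOp ∈ A) (hstar : starOp ∈ A) (hproj : ∀ S, projOp S Finset.univ ∈ A)
    (hshift : ∀ D, shiftOp D ∈ A) : A = ⊤ := by
  have h2 : (2 : F) = 0 := CharTwo.two_eq_zero
  set N : Module.End F (RootSpace F m X) := starOp - 1 with hN
  set E : Module.End F (RootSpace F m X) := N * thetaOp - N with hE
  have hNA : N ∈ A := A.sub_mem hstar A.one_mem
  have hEA : E ∈ A := A.sub_mem (A.mul_mem hNA htheta) hNA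
  have hN' : ∀ w S, N w S = ⟨(w S).im, 0⟩ := fun w S => by
    ext
    · simp [hN, starOp]
    · simp only [hN, starOp, LinearMap.sub_apply, LinearMap.coe_mk, AddHom.coe_mk, Pi.sub_apply,
        im_sub, im_star, Module.End.one_apply]
      linear_combination -(w S).im * h2
  have hE' : ∀ w S, E w S = ⟨(w S).re, 0⟩ := fun w S => by
    ext <;> simp [hE, hN', thetaOp]
  refine Algebra.eq_top_iff.2 fun T => ?_
  let c (S S' : Finset (Fin m)) (z : QuadraticAlgebra F X 1) : QuadraticAlgebra F X 1 :=
    T (Pi.single S' z) S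
  have hT : T = ∑ S, ∑ S', projOp S Finset.univ * ((c S S' 1).re • E + (c S S' ω).re • N
      + (c S S' 1).im • (thetaOp * E) + (c S S' ω).im • (thetaOp * N)) * shiftOp (symmDiff S S') := by
    refine LinearMap.ext fun w => funext fun S => ?_
    have hz : ∀ z : QuadraticAlgebra F X 1, z = z.re • 1 + z.im • ω := fun z => by
      ext <;> simp
    have hw : T w S = ∑ S', ((w S').re • c S S' 1 + (w S').im • c S S' ω) := by
      conv_lhs => rw [← Finset.univ_sum_single w, map_sum, Finset.sum_apply]
      refine Finset.sum_congr rfl fun S' _ => ?_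
      conv_lhs => rw [hz (w S')]
      simp only [Pi.single_add, Pi.single_smul, map_add, map_smul, c, Pi.add_apply, Pi.smul_apply]
    rw [hw]
    simp only [LinearMap.sum_apply, Finset.sum_apply, Module.End.mul_apply, projOp_univ_apply]
    rw [Finset.sum_comm]
    refine Finset.sum_congr rfl fun S' _ => ?_
    rw [Finset.sum_ite_eq, if_pos (Finset.mem_univ _)]
    ext <;> simp [hN', hE', shiftOp, thetaOp] <;> ring
  rw [hT]
  refine A.sum_mem fun S _ => A.sum_mem fun S' _ => A.mul_mem (A.mul_mem (hproj S) ?_) (hshift _)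
  exact A.add_mem (A.add_mem (A.add_mem (A.smul_mem hEA _) (A.smul_mem hNA _))
    (A.smul_mem (A.mul_mem htheta hEA) _)) (A.smul_mem (A.mul_mem htheta hNA) _)

theorem eq_top_of_uOp_mem_of_vOp_mem [CharP F 2]
    {A : Subalgebra F (Module.End F (RootSpace F m X))} {Y : Fin m → F}
    (hY : ∀ i, Y i ≠ 0) (hu : ∀ i, uOp m X i ∈ A) (hv : ∀ i, vOp X Y i ∈ A) : A = ⊤ := by
  have htheta : thetaOp ∈ A := by simpa [uOp] using hu (Fin.last m)
  have hodd : ∀ i, oddOp i ∈ A := fun i => by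
    simpa [uOp] using A.sub_mem (hu i.castSucc) htheta
  have hroot : ∀ i, rootOp Y i ∈ A := fun i => by simpa [vOp] using hv i.castSucc
  have hprod := rootProdOp_mem hY hodd hroot
  refine eq_top_of_mem htheta ?_ (fun S => projOp_mem hodd _ _) (shiftOp_mem hY hodd hroot)
  have h : starOp = (∏ i, Y i)⁻¹ • (vOp X Y (Fin.last m) * rootProdOp Y) := by
    rw [vOp, Fin.snoc_last, mul_assoc, rootProdOp_sq, ← Algebra.commutes, ← Algebra.smul_def,
      smul_smul, inv_mul_cancel₀ (Finset.prod_ne_zero_iff.2 fun i _ => hY i), one_smul]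
  rw [h]
  exact A.smul_mem (A.mul_mem (hv _) hprod) _

end RootSpace

theorem QuatAlg.mem_of_map_u_of_map_v {F : Type*} [Field F] {a b : F} {A : Type*} [Ring A]
    [Algebra F A] (φ : QuatAlg F a b →ₐ[F] A) (S : Subalgebra F A) (hu : φ (u a b) ∈ S)
    (hv : φ (v a b) ∈ S) (x : QuatAlg F a b) : φ x ∈ S := by
  have h : Algebra.adjoin F {u a b, v a b} ≤ S.comap φ :=
    Algebra.adjoin_le fun z hz => by rcases hz with rfl | rfl <;> assumption
  exact h (adjoin_eq_top a b ▸ Algebra.mem_top)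

theorem QuatAlg.commute_map {F : Type*} [Field F] {a b : F} {A : Type*} [Ring A] [Algebra F A]
    (φ : QuatAlg F a b →ₐ[F] A) {z : A} (hu : Commute (φ (u a b)) z) (hv : Commute (φ (v a b)) z)
    (x : QuatAlg F a b) : Commute (φ x) z :=
  ((Subalgebra.mem_centralizer_iff F).1 (mem_of_map_u_of_map_v φ (Subalgebra.centralizer F {z})
    ((Subalgebra.mem_centralizer_iff F).2 fun _ hg => hg ▸ hu.eq.symm)
    ((Subalgebra.mem_centralizer_iff F).2 fun _ hg => hg ▸ hv.eq.symm) x) z rfl).symm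

theorem QuatAlg.commute_map_map {F : Type*} [Field F] {a b a' b' : F} {A : Type*} [Ring A]
    [Algebra F A] (φ : QuatAlg F a b →ₐ[F] A) (ψ : QuatAlg F a' b' →ₐ[F] A)
    (huu : Commute (φ (u a b)) (ψ (u a' b'))) (huv : Commute (φ (u a b)) (ψ (v a' b')))
    (hvu : Commute (φ (v a b)) (ψ (u a' b'))) (hvv : Commute (φ (v a b)) (ψ (v a' b')))
    (x : QuatAlg F a b) (y : QuatAlg F a' b') : Commute (φ x) (ψ y) :=
  commute_map φ (commute_map ψ huu.symm huv.symm y).symm (commute_map ψ hvu.symm hvv.symm y).symm x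

namespace RootSpace

variable {F : Type*} [Field F] [CharP F 2] {m : ℕ} (X : F) (Y : Fin m → F)

/-- The action of the `i`-th quaternion algebra on `RootSpace F m X`. -/
def quatHom (i : Fin (m + 1)) :
    QuatAlg F X ((Fin.snoc Y (∏ i, Y i) : Fin (m + 1) → F) i) →ₐ[F]
      Module.End F (RootSpace F m X) :=
  QuatAlg.lift (uOp m X i) (vOp X Y i) (uOp_sq i) (vOp_sq Y i) (vOp_mul_uOp Y i)

theorem pairwise_commute_quatHom :
    Pairwise fun i j => ∀ x y, Commute (quatHom X Y i x) (quatHom X Y j y) := fun i j hij =>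
  QuatAlg.commute_map_map _ _ (by simpa [quatHom] using commute_uOp_uOp i j)
    (by simpa [quatHom] using commute_uOp_vOp Y hij)
    (by simpa [quatHom] using (commute_uOp_vOp Y hij.symm).symm)
    (by simpa [quatHom] using commute_vOp_vOp Y i j)

theorem liftCommute_quatHom_surjective (hY : ∀ i, Y i ≠ 0) : Function.Surjective
    (PiTensorProduct.liftCommute (quatHom X Y) (pairwise_commute_quatHom X Y)) := by
  rw [← AlgHom.range_eq_top]
  refine eq_top_of_uOp_mem_of_vOp_mem hY (fun i => ?_) fun i => ?_
  · exact ⟨PiTensorProduct.singleAlgHom i (QuatAlg.u _ _),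
      (PiTensorProduct.liftCommute_singleAlgHom _ _ _ _).trans (QuatAlg.lift_u _ _ _)⟩
  · exact ⟨PiTensorProduct.singleAlgHom i (QuatAlg.v _ _),
      (PiTensorProduct.liftCommute_singleAlgHom _ _ _ _).trans (QuatAlg.lift_v _ _ _)⟩

omit [CharP F 2] in
theorem finrank_rootSpace : Module.finrank F (RootSpace F m X) = 2 ^ (m + 1) := by
  rw [Module.finrank_pi_fintype]
  simp [QuadraticAlgebra.finrank_eq_two, pow_succ]

theorem nonempty_algEquiv_matrix (hY : ∀ i, Y i ≠ 0) : Nonempty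
    ((⨂[F] i : Fin (m + 1), QuatAlg F X ((Fin.snoc Y (∏ i, Y i) : Fin (m + 1) → F) i)) ≃ₐ[F]
      Matrix (Fin (2 ^ (m + 1))) (Fin (2 ^ (m + 1))) F) := by
  have hs := liftCommute_quatHom_surjective X Y hY
  set ρ := PiTensorProduct.liftCommute (quatHom X Y) (pairwise_commute_quatHom X Y)
  have hle : Module.finrank F
      (⨂[F] i : Fin (m + 1), QuatAlg F X ((Fin.snoc Y (∏ i, Y i) : Fin (m + 1) → F) i)) ≤
      Module.finrank F (Module.End F (RootSpace F m X)) := by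
    rw [Module.finrank_piTensorProduct, Module.finrank_linearMap, finrank_rootSpace, ← mul_pow]
    refine (Finset.prod_le_pow_card _ _ 4 fun i _ => QuatAlg.finrank_le _ _).trans ?_
    simp
  have hge := LinearMap.finrank_le_finrank_of_surjective (f := ρ.toLinearMap) hs
  have hi : Function.Injective ρ :=
    (LinearMap.injective_iff_surjective_of_finrank_eq_finrank (f := ρ.toLinearMap)
      (hle.antisymm hge)).2 hs
  let b := (Module.finBasis F (RootSpace F m X)).reindex (finCongr (finrank_rootSpace X))
  exact ⟨(AlgEquiv.ofBijective ρ ⟨hi, hs⟩).trans (LinearMap.toMatrixAlgEquiv b)⟩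

end RootSpace

theorem QuatAlg.mul_self_eq {F : Type*} [Field F] {a b : F} (c₀ c₁ c₂ c₃ : F) {x : QuatAlg F a b}
    (hx : x = algebraMap F _ c₀ + c₁ • u a b + c₂ • v a b + c₃ • (u a b * v a b)) :
    x * x = (2 * c₀ + c₁) • x + algebraMap F _
      (a * c₁ ^ 2 + b * (c₂ ^ 2 + c₂ * c₃ - a * c₃ ^ 2) - c₀ ^ 2 - c₀ * c₁) := by
  have huu : u a b * u a b = u a b + a • 1 := by
    rw [u_mul_u, Algebra.algebraMap_eq_smul_one]
  have hvv : v a b * v a b = b • 1 := by rw [v_mul_v, Algebra.algebraMap_eq_smul_one]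
  have hvu : v a b * u a b = v a b - u a b * v a b := by rw [v_mul_u, sub_mul, one_mul]
  have h1 : u a b * (u a b * v a b) = u a b * v a b + a • v a b := by
    rw [← mul_assoc, huu, add_mul, smul_mul_assoc, one_mul]
  have h2 : v a b * (u a b * v a b) = b • 1 - b • u a b := by
    rw [← mul_assoc, hvu, sub_mul, mul_assoc, hvv, mul_smul_comm, mul_one]
  have h3 : u a b * v a b * u a b = - a • v a b := by
    rw [mul_assoc, hvu, mul_sub, h1]; module
  have h4 : u a b * v a b * v a b = b • u a b := by
    rw [mul_assoc, hvv, mul_smul_comm, mul_one]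
  have h5 : u a b * v a b * (u a b * v a b) = -(a * b) • 1 := by
    rw [← mul_assoc, h3, smul_mul_assoc, hvv]; module
  subst hx
  simp only [Algebra.algebraMap_eq_smul_one, mul_add, add_mul, smul_mul_assoc, mul_smul_comm,
    one_mul, mul_one, huu, hvv, hvu, h1, h2, h3, h4, h5]
  module

namespace RootSpace

variable {F : Type*} [Field F] [CharP F 2] {m : ℕ} {X : F} {Y : Fin m → F}

theorem quatHom_u (i : Fin (m + 1)) : quatHom X Y i (QuatAlg.u _ _) = uOp m X i :=
  QuatAlg.lift_u _ _ _

theorem quatHom_v (i : Fin (m + 1)) : quatHom X Y i (QuatAlg.v _ _) = vOp X Y i :=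
  QuatAlg.lift_v _ _ _

theorem exists_mul_self_eq_and_form_quatHom_left (i : Fin (m + 1))
    (x : QuatAlg F X ((Fin.snoc Y (∏ i, Y i) : Fin (m + 1) → F) i)) :
    ∃ t n : F, x * x = t • x + algebraMap F _ n ∧ ∀ w w',
      form Y (quatHom X Y i x w) w' = form Y w (quatHom X Y i x w') + t * form Y w w' := by
  obtain ⟨c₀, c₁, c₂, c₃, hx⟩ := QuatAlg.exists_eq _ _ x
  have h2 : (2 : F) = 0 := CharTwo.two_eq_zero
  refine ⟨_, _, QuatAlg.mul_self_eq c₀ c₁ c₂ c₃ hx, fun w w' => ?_⟩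
  have huv : form Y (uOp m X i (vOp X Y i w)) w' = form Y w (uOp m X i (vOp X Y i w')) := by
    rw [form_uOp_left, form_vOp_left, ← Module.End.mul_apply, mul_sub, vOp_mul_uOp, sub_mul,
      one_mul, mul_one, sub_sub_cancel, Module.End.mul_apply]
  simp only [hx, map_add, map_smul, map_mul, AlgHom.commutes, quatHom_u, quatHom_v,
    LinearMap.add_apply, LinearMap.smul_apply, Module.End.mul_apply, Module.algebraMap_end_apply,
    huv, form_uOp_left, form_vOp_left, LinearMap.sub_apply, Module.End.one_apply, map_sub,
    smul_eq_mul]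
  linear_combination (-c₀ * form Y w w' - c₁ * form Y w (uOp m X i w')) * h2

variable {i : Fin (m + 1)} {x y : QuatAlg F X ((Fin.snoc Y (∏ i, Y i) : Fin (m + 1) → F) i)}
  {a b : F}

instance : Nontrivial (QuatAlg F X ((Fin.snoc Y (∏ i, Y i) : Fin (m + 1) → F) i)) :=
  (quatHom X Y i).toRingHom.domain_nontrivial

theorem form_quatHom_left_of_mul_self_eq_add (hb : b ≠ 0) (hx : x * x - x = algebraMap F _ a)
    (hy : y * y = algebraMap F _ b) (hyx : y * x = (1 - x) * y) (w w' : RootSpace F m X) :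
    form Y (quatHom X Y i x w) w' = form Y w (quatHom X Y i (1 - x) w') := by
  obtain ⟨t, n, h, hf⟩ := exists_mul_self_eq_and_form_quatHom_left i x
  have ht : t = 1 := by
    by_contra ht
    have hx' : x = algebraMap F _ ((t - 1)⁻¹ * (a - n)) := by
      have : (t - 1) • x = algebraMap F _ (a - n) := by
        rw [map_sub, ← hx, h]; module
      rw [map_mul, ← this, ← Algebra.smul_def, smul_smul, inv_mul_cancel₀ (sub_ne_zero.2 ht),
        one_smul]
    rw [sub_mul, one_mul, hx', ← Algebra.commutes, eq_sub_iff_add_eq, ← two_smul F,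
      CharTwo.two_eq_zero, zero_smul] at hyx
    rw [← hyx, mul_zero, eq_comm, map_eq_zero_iff _ (algebraMap F _).injective] at hy
    exact hb hy
  have h2 : (2 : F) = 0 := CharTwo.two_eq_zero
  rw [hf, ht, map_sub, map_one, LinearMap.sub_apply, map_sub, Module.End.one_apply]
  linear_combination form Y w (quatHom X Y i x w') * h2

theorem form_quatHom_left_of_mul_self_eq (hb : b ≠ 0)
    (hy : y * y = algebraMap F _ b) (hyx : y * x = (1 - x) * y) (w w' : RootSpace F m X) :
    form Y (quatHom X Y i y w) w' = form Y w (quatHom X Y i y w') := by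
  obtain ⟨t, n, h, hf⟩ := exists_mul_self_eq_and_form_quatHom_left i y
  have ht : t = 0 := by
    by_contra ht
    have hy' : y = algebraMap F _ (t⁻¹ * (b - n)) := by
      have : t • y = algebraMap F _ (b - n) := by
        rw [map_sub, ← hy, h]; module
      rw [map_mul, ← this, ← Algebra.smul_def, smul_smul, inv_mul_cancel₀ ht, one_smul]
    rw [sub_mul, one_mul, hy', Algebra.commutes, ← hy', eq_sub_iff_add_eq, ← two_smul F,
      CharTwo.two_eq_zero, zero_smul] at hyx
    rw [← hyx, mul_zero, eq_comm, map_eq_zero_iff _ (algebraMap F _).injective] at hy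
    exact hb hy
  rw [hf, ht, zero_mul, add_zero]

theorem form_quatHom_last_self (hm : 1 ≤ m)
    {x : QuatAlg F X ((Fin.snoc Y (∏ i, Y i) : Fin (m + 1) → F) (Fin.last m))}
    (hx : ∀ w w', form Y (quatHom X Y (Fin.last m) x w) w' =
      form Y w (quatHom X Y (Fin.last m) (1 - x) w')) (w : RootSpace F m X) :
    form Y w (quatHom X Y (Fin.last m) x w) = form Y w (uOp m X (Fin.last m) w) := by
  have h2 : (2 : F) = 0 := CharTwo.two_eq_zero
  set D : Module.End F (RootSpace F m X) := quatHom X Y (Fin.last m) x - uOp m X (Fin.last m)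
    with hD
  have hDadj : ∀ w w', form Y (D w) w' = form Y w (D w') := fun w w' => by
    rw [hD, LinearMap.sub_apply, map_sub, LinearMap.sub_apply, hx, form_uOp_left]
    simp only [map_sub, map_one, LinearMap.sub_apply, Module.End.one_apply]
    linear_combination (form Y w (uOp m X (Fin.last m) w') -
      form Y w (quatHom X Y (Fin.last m) x w')) * h2
  have hne : Fin.last m ≠ 0 := by
    rw [Ne, Fin.ext_iff]; simp only [Fin.val_last, Fin.val_zero]; omega
  have hcomm : D * uOp m X 0 = uOp m X 0 * D := by
    have h := pairwise_commute_quatHom X Y hne (x - QuatAlg.u _ _) (QuatAlg.u _ _)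
    rwa [map_sub, quatHom_u, quatHom_u] at h
  have h1 : form Y w ((1 - uOp m X 0 : Module.End F _) (D w)) = form Y w (uOp m X 0 (D w)) := by
    rw [← form_uOp_left, ← Module.End.mul_apply, ← hcomm, Module.End.mul_apply, ← hDadj,
      form_comm]
  rw [← sub_eq_zero, ← map_sub, ← LinearMap.sub_apply, ← hD]
  rw [LinearMap.sub_apply, Module.End.one_apply, map_sub] at h1
  linear_combination h1 + form Y w (uOp m X 0 (D w)) * h2

end RootSpace

/-- Anything provable about adjoints of the generators extends to the tensor product. -/
theorem exists_adjoint_of_generators {L F W ι : Type*} [Field L] [Field F] [Algebra L F]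
    [AddCommGroup W] [Module F W] [Module L W] [IsScalarTower L F W] [SMulCommClass F L W]
    [Fintype ι] [DecidableEq ι] {a b : ι → L}
    (f : (⨂[L] i, QuatAlg L (a i) (b i)) →ₐ[L] Module.End F W)
    (B : W →ₗ[F] W →ₗ[F] F)
    (hu : ∀ i, ∃ z, ∀ w w', B (f (PiTensorProduct.singleAlgHom i (QuatAlg.u _ _)) w) w' =
      B w (f z w'))
    (hv : ∀ i, ∃ z, ∀ w w', B (f (PiTensorProduct.singleAlgHom i (QuatAlg.v _ _)) w) w' =
      B w (f z w')) (x : ⨂[L] i, QuatAlg L (a i) (b i)) :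
    ∃ z, ∀ w w', B (f x w) w' = B w (f z w') := by
  have hB : ∀ (c : L) (w w' : W), B (c • w) w' = B w (c • w') := fun c w w' => by
    rw [← algebraMap_smul F c w, ← algebraMap_smul F c w', map_smul, map_smul,
      LinearMap.smul_apply]
  let S : Subalgebra L (⨂[L] i, QuatAlg L (a i) (b i)) :=
    { carrier := {x | ∃ z, ∀ w w', B (f x w) w' = B w (f z w')}
      mul_mem' := fun {x y} ⟨x', hx⟩ ⟨y', hy⟩ => ⟨y' * x', fun w w' => by
        rw [map_mul, map_mul, Module.End.mul_apply, hx, hy, Module.End.mul_apply]⟩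
      add_mem' := fun {x y} ⟨x', hx⟩ ⟨y', hy⟩ => ⟨x' + y', fun w w' => by
        rw [map_add, map_add, LinearMap.add_apply, map_add, LinearMap.add_apply, hx, hy,
          LinearMap.add_apply, map_add]⟩
      algebraMap_mem' := fun c => ⟨algebraMap L _ c, fun w w' => by
        rw [AlgHom.commutes, Module.algebraMap_end_apply, Module.algebraMap_end_apply, hB]⟩ }
  have hS : S = ⊤ := by
    rw [eq_top_iff, ← PiTensorProduct.iSup_range_singleAlgHom, iSup_le_iff]
    rintro i _ ⟨q, rfl⟩
    exact QuatAlg.mem_of_map_u_of_map_v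
      (PiTensorProduct.singleAlgHom (R := L) (A := fun i => QuatAlg L (a i) (b i)) i) S
      (hu i) (hv i) q
  exact (hS ▸ Algebra.mem_top : x ∈ S)

namespace RootSpace

theorem false_of_descent {F : Type*} [Field F] [CharP F 2] {m : ℕ} (hm : 1 ≤ m) {X : F}
    {Y : Fin m → F} {L : Type*} [Field L] [Algebra L F] {a b : Fin (m + 1) → L}
    (hb : ∀ i, b i ≠ 0)
    (e : ∀ i, QuatAlg F (algebraMap L F (a i)) (algebraMap L F (b i)) ≃ₐ[F]
      QuatAlg F X ((Fin.snoc Y (∏ i, Y i) : Fin (m + 1) → F) i))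
    {n : Type*} [Fintype n] [DecidableEq n] [Nonempty n]
    (ψ : Matrix n n L ≃ₐ[L] ⨂[L] i, QuatAlg L (a i) (b i))
    (haniso : ∀ w : RootSpace F m X, ∑ S, (∏ i ∈ S, Y i) *
      ((w S).re ^ 2 + (w S).re * (w S).im - X * (w S).im ^ 2) = 0 → w = 0)
    (hiso : ∀ C : n → n → L, ∃ x : n → L, x ≠ 0 ∧ ∑ i, ∑ j, C i j * x i * x j = 0) : False := by
  let x i := e i (QuatAlg.u _ _)
  let y i := e i (QuatAlg.v _ _)
  have hx : ∀ i, x i * x i - x i = algebraMap F _ (algebraMap L F (a i)) := fun i => by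
    rw [← map_mul, ← map_sub, QuatAlg.u_mul_u, add_sub_cancel_left, AlgEquiv.commutes]
  have hy : ∀ i, y i * y i = algebraMap F _ (algebraMap L F (b i)) := fun i => by
    rw [← map_mul, QuatAlg.v_mul_v, AlgEquiv.commutes]
  have hyx : ∀ i, y i * x i = (1 - x i) * y i := fun i => by
    rw [← map_mul, QuatAlg.v_mul_u, map_mul, map_sub, map_one]
  have hb' : ∀ i, algebraMap L F (b i) ≠ 0 := fun i => by simpa using hb i
  have hxadj i := form_quatHom_left_of_mul_self_eq_add (hb' i) (hx i) (hy i) (hyx i)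
  have hyadj i := form_quatHom_left_of_mul_self_eq (hb' i) (hy i) (hyx i)
  have hcomm := pairwise_commute_quatHom X Y
  let φ i : QuatAlg L (a i) (b i) →ₐ[L] Module.End F (RootSpace F m X) :=
    QuatAlg.lift (quatHom X Y i (x i)) (quatHom X Y i (y i))
      (by rw [← map_mul, ← map_sub, hx, AlgHom.commutes, ← IsScalarTower.algebraMap_apply])
      (by rw [← map_mul, hy, AlgHom.commutes, ← IsScalarTower.algebraMap_apply])
      (by rw [← map_mul, hyx, map_mul, map_sub, map_one])
  have hφu i : φ i (QuatAlg.u _ _) = quatHom X Y i (x i) := QuatAlg.lift_u _ _ _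
  have hφv i : φ i (QuatAlg.v _ _) = quatHom X Y i (y i) := QuatAlg.lift_v _ _ _
  have hφ : Pairwise fun i j => ∀ x y, Commute (φ i x) (φ j y) := fun i j hij =>
    QuatAlg.commute_map_map _ _ (by simpa only [hφu] using hcomm hij _ _)
      (by simpa only [hφu, hφv] using hcomm hij _ _) (by simpa only [hφu, hφv] using hcomm hij _ _)
      (by simpa only [hφv] using hcomm hij _ _)
  let f := PiTensorProduct.liftCommute φ hφ
  have hfu i : f (PiTensorProduct.singleAlgHom i (QuatAlg.u _ _)) = quatHom X Y i (x i) :=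
    (PiTensorProduct.liftCommute_singleAlgHom _ _ _ _).trans (hφu i)
  have hfv i : f (PiTensorProduct.singleAlgHom i (QuatAlg.v _ _)) = quatHom X Y i (y i) :=
    (PiTensorProduct.liftCommute_singleAlgHom _ _ _ _).trans (hφv i)
  have hadj := exists_adjoint_of_generators f (form Y)
    (fun i => ⟨1 - PiTensorProduct.singleAlgHom (R := L) (A := fun i => QuatAlg L (a i) (b i)) i
      (QuatAlg.u (a i) (b i)), fun w w' => by
      rw [hfu, hxadj, map_sub, map_sub, map_one, map_one, hfu]⟩)
    (fun i => ⟨PiTensorProduct.singleAlgHom i (QuatAlg.v _ _), fun w w' => by rw [hfv, hyadj]⟩)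
  refine false_of_matrix_action (f.comp ψ.toAlgHom) (form Y) (fun M => ?_)
    (ψ.symm (PiTensorProduct.singleAlgHom (Fin.last m) (QuatAlg.u _ _))) (fun w hw => ?_) hiso
  · obtain ⟨z, hz⟩ := hadj (ψ M)
    exact ⟨ψ.symm z, fun w w' => by simpa using hz w w'⟩
  · have h : form Y w (f (ψ (ψ.symm (PiTensorProduct.singleAlgHom (Fin.last m)
        (QuatAlg.u _ _)))) w) = 0 := hw
    rw [AlgEquiv.apply_symm_apply, hfu, form_quatHom_last_self hm (hxadj _),
      form_uOp_last_self] at h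
    exact haniso w h

end RootSpace

theorem cardinalMk_le_trdeg {k L : Type*} [CommRing k] [CommRing L] [Algebra k L] {s : Set L}
    (hs : AlgebraicIndependent k ((↑) : s → L)) : Cardinal.mk s ≤ trdeg k L :=
  le_ciSup (f := fun s : {s : Set L // AlgebraicIndependent k ((↑) : s → L)} => Cardinal.mk s.1)
    Cardinal.bddAbove_of_small ⟨s, hs⟩

theorem Yvar_ne_zero (k : Type*) [Field k] (m : ℕ) (i : Fin m) : Yvar k m i ≠ 0 := by
  have : IsFractionRing (MvPolynomial (Fin (m + 1)) k) (RatFunc' k m) :=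
    inferInstanceAs (IsFractionRing (MvPolynomial (Fin (m + 1)) k)
      (FractionRing (MvPolynomial (Fin (m + 1)) k)))
  exact (map_ne_zero_iff _ (IsFractionRing.injective _ _)).2 (MvPolynomial.X_ne_zero _)

set_option maxSynthPendingDepth 3 in
set_option maxHeartbeats 1000000 in
set_option synthInstance.maxHeartbeats 1000000 in
theorem stmt8 (k : Type*) [Field k] [IsAlgClosed k] [CharP k 2] (m : ℕ) (hm : 1 ≤ m) :
    Nonempty
      ((⨂[RatFunc' k m] i : Fin (m + 1), QuatAlg (RatFunc' k m) (Xvar k m) (bslot k m i))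
        ≃ₐ[RatFunc' k m] Matrix (Fin (2 ^ (m + 1))) (Fin (2 ^ (m + 1))) (RatFunc' k m)) ∧
    ¬ ∃ L : IntermediateField k (RatFunc' k m), trdeg k L ≤ (m : Cardinal) ∧
        ∃ a' b' : Fin (m + 1) → L, (∀ i, b' i ≠ 0) ∧
          (∀ i, Nonempty (QuatAlg (RatFunc' k m) (a' i : RatFunc' k m) (b' i : RatFunc' k m)
            ≃ₐ[RatFunc' k m] QuatAlg (RatFunc' k m) (Xvar k m) (bslot k m i))) ∧
          Nonempty
            ((⨂[L] i : Fin (m + 1), QuatAlg L (a' i) (b' i)) ≃ₐ[L]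
              Matrix (Fin (2 ^ (m + 1))) (Fin (2 ^ (m + 1))) L) := by
  have : CharP (RatFunc' k m) 2 := charP_of_injective_algebraMap' k 2
  refine ⟨RootSpace.nonempty_algEquiv_matrix _ _ (Yvar_ne_zero k m), ?_⟩
  rintro ⟨L, hL, a, b, hb, he, ⟨ψ⟩⟩
  refine RootSpace.false_of_descent hm hb (fun i => (he i).some) ψ.symm
    (fun w => RootSpace.eq_zero_of_sum_normForm_eq_zero)
    (exists_quadratic_zero_of_trdeg_le (k := k) (m := m)
      (fun s hs => (cardinalMk_le_trdeg hs).trans hL) ?_)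
  rw [Fintype.card_fin]
  exact Nat.pow_lt_pow_right one_lt_two m.lt_succ_self
end
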